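/- arXiv:2411.16376 — 3 statements merged into one kernel-verified Lean document; each statement's English description precedes it below -/
import Mathlib

section
/- Let 0 ≤ α < β ≤ 1, C₁, C₂ > 0, and let X be the killed subordinator with Laplace exponent Φ(z) = C₁ z^α + C₂ z^β. Then the restriction to (0,∞) of the potential measure U of X admits a continuous density u given explicitly by u(x) = (x^{β-1}/C₂) E_{β-α,β}(-C₁ x^{β-α}/C₂) for all x ∈ (0,∞), where E_{a,b}(z) = Σ_{k≥0} z^k/Γ(ka+b) is the two-parameter Mittag-Leffler function. -/
open Complex MeasureTheory
open scoped ENNReal NNReal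

/-- The two-parameter Mittag-Leffler function `E_{a,b}(x) = Σ_{k≥0} x^k / Γ(ka+b)`
(real argument). -/
noncomputable def mittagLeffler2 (a b x : ℝ) : ℝ :=
  ∑' k : ℕ, x ^ k / Real.Gamma (k * a + b)


lemma aux_integrable_real {b s : ℝ} (hb : 0 < b) (hs : 0 < s) :
    IntegrableOn (fun x : ℝ => x ^ (b - 1) * Real.exp (-(s * x))) (Set.Ioi 0) := by
  have := integrableOn_rpow_mul_exp_neg_mul_rpow (p := 1) (s := b - 1) (b := s) (by linarith)
    one_pos hs
  simpa using this

lemma aux_gamma {b : ℝ} (hb : 0 < b) {z : ℂ} (hz : 0 < z.re) :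
    ∫ x in Set.Ioi (0:ℝ), ((x ^ (b - 1) : ℝ) : ℂ) * Complex.exp (-z * x)
      = (1 / z) ^ (b : ℂ) * (Real.Gamma b : ℂ) := by
  set μ : Measure ℝ := (volume.restrict (Set.Ioi 0)).withDensity
    (fun x => ENNReal.ofReal (x ^ (b - 1))) with hμ
  have hmeas : Measurable (fun x : ℝ => ENNReal.ofReal (x ^ (b - 1))) := by fun_prop
  have key : ∀ w : ℂ, ProbabilityTheory.complexMGF id μ w
      = ∫ x in Set.Ioi (0:ℝ), ((x ^ (b - 1) : ℝ) : ℂ) * Complex.exp (w * x) := by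
    intro w
    rw [ProbabilityTheory.complexMGF, hμ, integral_withDensity_eq_integral_toReal_smul hmeas
      (by simp)]
    refine setIntegral_congr_fun measurableSet_Ioi fun x hx => ?_
    have : 0 ≤ x ^ (b - 1) := Real.rpow_nonneg (le_of_lt hx) _
    simp [ENNReal.toReal_ofReal this]
  have hint : Set.Iio 0 ⊆ ProbabilityTheory.integrableExpSet id μ := by
    intro t ht
    have ht' : 0 < -t := by simpa using ht
    rw [ProbabilityTheory.integrableExpSet, Set.mem_ofPred_eq, hμ,
      integrable_withDensity_iff_integrable_smul' hmeas (by simp)]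
    refine (aux_integrable_real hb ht').congr ?_
    refine (ae_restrict_mem measurableSet_Ioi).mono fun x hx => ?_
    have : 0 ≤ x ^ (b - 1) := Real.rpow_nonneg (le_of_lt hx) _
    simp [ENNReal.toReal_ofReal this]
  have hsub : Set.Iio 0 ⊆ interior (ProbabilityTheory.integrableExpSet id μ) :=
    interior_maximal hint isOpen_Iio
  let S : Set ℂ := {w | w.re < 0}
  have hSopen : IsOpen S := isOpen_lt Complex.continuous_re continuous_const
  have hF : AnalyticOnNhd ℂ (ProbabilityTheory.complexMGF id μ) S := fun w hw =>
    ProbabilityTheory.analyticAt_complexMGF (hsub hw)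
  have hG : AnalyticOnNhd ℂ (fun w : ℂ => (1 / (-w)) ^ (b : ℂ) * (Real.Gamma b : ℂ)) S := by
    apply DifferentiableOn.analyticOnNhd _ hSopen
    intro w hw
    have hw' : 0 < (-w).re := by simpa [S] using hw
    have hne : -w ≠ 0 := by intro h; rw [h] at hw'; simp at hw'
    have hre : 0 < (1 / (-w)).re := by
      rw [one_div, Complex.inv_re]
      exact div_pos hw' (Complex.normSq_pos.2 hne)
    apply DifferentiableAt.differentiableWithinAt
    apply DifferentiableAt.mul_const
    apply DifferentiableAt.cpow_const
    · exact DifferentiableAt.div (by fun_prop) (by fun_prop) hne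
    · exact Or.inl hre
  have hEq : Set.EqOn (ProbabilityTheory.complexMGF id μ)
      (fun w : ℂ => (1 / (-w)) ^ (b : ℂ) * (Real.Gamma b : ℂ)) S := by
    refine hF.eqOn_of_preconnected_of_frequently_eq hG
      ((convex_halfSpace_re_lt 0).isPreconnected) (z₀ := -1) (by simp [S]) ?_
    have hr : ∀ r : ℝ, 0 < r → ProbabilityTheory.complexMGF id μ (-(r:ℂ)) =
        (1 / (-(-(r:ℂ)))) ^ (b : ℂ) * (Real.Gamma b : ℂ) := by
      intro r hr
      rw [key, neg_neg, ← Complex.Gamma_ofReal,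
        ← Complex.integral_cpow_mul_exp_neg_mul_Ioi (by simpa using hb) hr]
      refine setIntegral_congr_fun measurableSet_Ioi fun x hx => ?_
      simp only [neg_mul]
      rw [Complex.ofReal_cpow (le_of_lt hx)]
      push_cast
      rfl
    have ht : Filter.Tendsto (fun r : ℝ => -(r : ℂ)) (nhdsWithin 1 {1}ᶜ)
        (nhdsWithin (-1) {-1}ᶜ) := by
      refine tendsto_nhdsWithin_of_tendsto_nhds_of_eventually_within _ ?_ ?_
      · have : Filter.Tendsto (fun r : ℝ => -(r : ℂ)) (nhds 1) (nhds (-((1:ℝ):ℂ))) :=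
          Continuous.tendsto (by fun_prop) _
        simp only [Complex.ofReal_one] at this
        exact this.mono_left nhdsWithin_le_nhds
      · filter_upwards [self_mem_nhdsWithin] with r hr
        simp only [Set.mem_compl_iff, Set.mem_singleton_iff, neg_inj] at hr ⊢
        exact_mod_cast hr
    refine ht.frequently (Filter.Eventually.frequently ?_)
    filter_upwards [nhdsWithin_le_nhds (lt_mem_nhds (zero_lt_one' ℝ))] with r hr0
    exact hr r hr0
  have := hEq (x := -z) (by simpa [S] using hz)
  rw [key] at this
  simpa using this

lemma aux_gamma_lower {b M : ℝ} (hb : 1 ≤ b) (hM : 0 < M) :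
    M ^ (b - 1) * Real.exp (-M) ≤ Real.Gamma b := by
  rw [Real.Gamma_eq_integral (by linarith), ← integral_exp_neg_Ioi, ← integral_const_mul]
  have hi := Real.GammaIntegral_convergent (s := b) (by linarith)
  have hsub : Set.Ioi M ⊆ Set.Ioi (0:ℝ) := Set.Ioi_subset_Ioi hM.le
  calc ∫ x in Set.Ioi M, M ^ (b - 1) * Real.exp (-x)
      ≤ ∫ x in Set.Ioi M, Real.exp (-x) * x ^ (b - 1) := by
        refine setIntegral_mono_on ((integrableOn_exp_neg_Ioi M).const_mul _)
          (hi.mono_set hsub) measurableSet_Ioi fun x hx => ?_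
        rw [mul_comm]
        gcongr
        exact le_of_lt hx
    _ ≤ _ := by
        refine setIntegral_mono_set hi ?_ hsub.eventuallyLE
        refine (ae_restrict_mem measurableSet_Ioi).mono fun x hx => ?_
        have : 0 ≤ x ^ (b - 1) := Real.rpow_nonneg (le_of_lt hx) _
        simp only [Pi.zero_apply]
        positivity

lemma aux_summable {a b R : ℝ} (ha : 0 < a) (hb : 0 < b) (hR : 0 < R) :
    Summable (fun k : ℕ => R ^ k / Real.Gamma (k * a + b)) := by
  set M : ℝ := (2 * R) ^ (1 / a) with hMdef
  have hM : 0 < M := by positivity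
  have hMa : M ^ a = 2 * R := by
    rw [hMdef, ← Real.rpow_mul (by positivity), one_div, inv_mul_cancel₀ ha.ne', Real.rpow_one]
  have hg : Summable (fun k : ℕ => (Real.exp M / M ^ (b - 1)) * (1 / 2 : ℝ) ^ k) :=
    summable_geometric_two.mul_left _
  refine Summable.of_norm_bounded_eventually_nat hg ?_
  obtain ⟨N, hN⟩ := exists_nat_ge (1 / a)
  filter_upwards [Filter.eventually_ge_atTop N] with k hk
  have hka : 1 ≤ k * a := by
    have : 1 / a ≤ (k : ℝ) := hN.trans (by exact_mod_cast hk)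
    rwa [div_le_iff₀ ha] at this
  have hlow := aux_gamma_lower (b := k * a + b) (by linarith) hM
  have hpos : 0 < M ^ (k * a + b - 1) * Real.exp (-M) := by positivity
  have hG : 0 < Real.Gamma (k * a + b) := hpos.trans_le hlow
  rw [Real.norm_of_nonneg (by positivity)]
  calc R ^ k / Real.Gamma (k * a + b) ≤ R ^ k / (M ^ (k * a + b - 1) * Real.exp (-M)) := by
        gcongr
    _ = _ := by
        have : M ^ (k * a + b - 1) = (2 * R) ^ k * M ^ (b - 1) := by
          rw [add_sub_assoc, Real.rpow_add hM, mul_comm (k:ℝ) a, Real.rpow_mul hM.le, hMa,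
            Real.rpow_natCast]
        rw [this, Real.exp_neg, mul_pow, one_div, inv_pow]
        field_simp

lemma aux_continuous {a b : ℝ} (ha : 0 < a) (hb : 0 < b) :
    Continuous (mittagLeffler2 a b) := by
  rw [continuous_iff_continuousAt]
  intro x
  have hc : ContinuousOn (mittagLeffler2 a b) (Metric.ball 0 (|x| + 1)) := by
    unfold mittagLeffler2
    refine continuousOn_tsum (fun k => by fun_prop)
      (aux_summable ha hb (R := |x| + 1) (by positivity)) fun k y hy => ?_
    have hG : 0 < Real.Gamma (k * a + b) := Real.Gamma_pos_of_pos (by positivity)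
    rw [norm_div, Real.norm_of_nonneg hG.le, norm_pow]
    gcongr
    exact (mem_ball_zero_iff.1 hy).le
  exact hc.continuousAt (Metric.isOpen_ball.mem_nhds (by simp))

lemma aux_norm {b : ℝ} {z : ℂ} {x : ℝ} (hx : 0 < x) :
    ‖((x ^ (b - 1) : ℝ) : ℂ) * Complex.exp (-z * x)‖ = x ^ (b - 1) * Real.exp (-(z.re * x)) := by
  rw [norm_mul, Complex.norm_exp, Complex.norm_real,
    Real.norm_of_nonneg (Real.rpow_nonneg hx.le _)]
  simp

lemma aux_integrable {b : ℝ} (hb : 0 < b) {z : ℂ} (hz : 0 < z.re) :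
    IntegrableOn (fun x : ℝ => ((x ^ (b - 1) : ℝ) : ℂ) * Complex.exp (-z * x)) (Set.Ioi 0) := by
  refine (aux_integrable_real hb hz).mono' (by fun_prop) ?_
  exact (ae_restrict_mem measurableSet_Ioi).mono fun x hx => (aux_norm hx).le

lemma aux_laplace {α β C₁ C₂ : ℝ} (hβ : 0 < β) (hαβ : α < β) (hC₁ : 0 < C₁) (hC₂ : 0 < C₂)
    {z : ℂ} (hz : 0 < z.re) (hz1 : C₁ / C₂ * (1 / z.re) ^ (β - α) < 1) :
    (∫ x in Set.Ioi (0:ℝ), ((x ^ (β - 1) / C₂ *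
      mittagLeffler2 (β - α) β (-(C₁ * x ^ (β - α) / C₂)) : ℝ) : ℂ) * Complex.exp (-z * x))
      = 1 / ((C₁ : ℂ) * z ^ (α : ℂ) + (C₂ : ℂ) * z ^ (β : ℂ)) ∧
    ((C₁ : ℂ) * z ^ (α : ℂ) + (C₂ : ℂ) * z ^ (β : ℂ)) ≠ 0 := by
  set a := β - α with ha_def
  have ha : 0 < a := by linarith
  set c := C₁ / C₂ with hc_def
  have hc : 0 < c := by positivity
  have hb : ∀ k : ℕ, 0 < k * a + β := fun k => by positivity
  have hG : ∀ k : ℕ, 0 < Real.Gamma (k * a + β) := fun k => Real.Gamma_pos_of_pos (hb k)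
  have hz0 : z ≠ 0 := by intro h; simp [h] at hz
  have hw0 : 1 / z ≠ 0 := one_div_ne_zero hz0
  let F : ℕ → ℝ → ℂ := fun k x => (((-c) ^ k / Real.Gamma (k * a + β) / C₂ : ℝ) : ℂ) *
    (((x ^ (k * a + β - 1) : ℝ) : ℂ) * Complex.exp (-z * x))
  have hFi : ∀ k, Integrable (F k) (volume.restrict (Set.Ioi 0)) := fun k =>
    (aux_integrable (hb k) hz).const_mul _
  have hFn : ∀ k, ∫ x in Set.Ioi (0:ℝ), ‖F k x‖ =
      ((1 / z.re) ^ β / C₂) * (c * (1 / z.re) ^ a) ^ k := by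
    intro k
    have h1 : ∫ x in Set.Ioi (0:ℝ), ‖F k x‖ = ∫ x in Set.Ioi (0:ℝ),
        (c ^ k / Real.Gamma (k * a + β) / C₂) *
          (x ^ (k * a + β - 1) * Real.exp (-(z.re * x))) := by
      refine setIntegral_congr_fun measurableSet_Ioi fun x hx => ?_
      simp only [F]
      rw [norm_mul, aux_norm hx, Complex.norm_real, norm_div, norm_div, norm_pow, norm_neg,
        Real.norm_of_nonneg hc.le, Real.norm_of_nonneg hC₂.le, Real.norm_of_nonneg (hG k).le]
    rw [h1, integral_const_mul, Real.integral_rpow_mul_exp_neg_mul_Ioi (hb k) hz,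
      Real.rpow_add (by positivity), mul_comm (k:ℝ) a, Real.rpow_mul (by positivity),
      Real.rpow_natCast, mul_pow, mul_comm a (k:ℝ)]
    have := (hG k).ne'
    field_simp
  have hsum : Summable fun k => ∫ x in Set.Ioi (0:ℝ), ‖F k x‖ := by
    simp_rw [hFn]
    exact (summable_geometric_of_lt_one (by positivity) hz1).mul_left _
  have hval : ∀ k, ∫ x in Set.Ioi (0:ℝ), F k x =
      ((1 / z) ^ (β : ℂ) / C₂) * (-(c * (1 / z) ^ (a : ℂ))) ^ k := by
    intro k
    have hGk : ((Real.Gamma (k * a + β) : ℝ) : ℂ) ≠ 0 := by exact_mod_cast (hG k).ne'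
    have hC : (C₂ : ℂ) ≠ 0 := by exact_mod_cast hC₂.ne'
    simp only [F]
    rw [integral_const_mul, aux_gamma (hb k) hz]
    have : (1 / z) ^ ((k * a + β : ℝ) : ℂ) = ((1 / z) ^ (a : ℂ)) ^ k * (1 / z) ^ (β : ℂ) := by
      push_cast
      rw [Complex.cpow_add _ _ hw0, Complex.cpow_nat_mul]
    rw [this, ← neg_mul, mul_pow, Complex.ofReal_div, Complex.ofReal_div, Complex.ofReal_pow,
      Complex.ofReal_neg]
    field_simp
  have htsum := integral_tsum_of_summable_integral_norm hFi hsum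
  have hF : ∫ x in Set.Ioi (0:ℝ), ∑' k, F k x = ∫ x in Set.Ioi (0:ℝ), ((x ^ (β - 1) / C₂ *
      mittagLeffler2 a β (-(C₁ * x ^ a / C₂)) : ℝ) : ℂ) * Complex.exp (-z * x) := by
    refine setIntegral_congr_fun measurableSet_Ioi fun x hx => ?_
    have hx0 : 0 < x := hx
    simp only [F, mittagLeffler2]
    rw [← tsum_mul_left, Complex.ofReal_tsum, ← tsum_mul_right]
    refine tsum_congr fun k => ?_
    rw [← mul_assoc, ← Complex.ofReal_mul]
    congr 2
    rw [add_sub_assoc, Real.rpow_add hx0, mul_comm (k:ℝ) a, Real.rpow_mul hx0.le,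
      Real.rpow_natCast, hc_def, neg_pow, neg_pow (C₁ * x ^ a / C₂), div_pow, div_pow, mul_pow]
    ring
  have hq : ‖-((c : ℂ) * (1 / z) ^ (a : ℂ))‖ < 1 := by
    rw [norm_neg, norm_mul, Complex.norm_real, Real.norm_of_nonneg hc.le, Complex.norm_cpow_real]
    refine lt_of_le_of_lt ?_ hz1
    rw [norm_div, norm_one]
    have : z.re ≤ ‖z‖ := (le_abs_self _).trans (Complex.abs_re_le_norm z)
    gcongr
  have harg : z.arg ≠ Real.pi := by
    intro h
    rw [Complex.arg_eq_pi_iff] at h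
    linarith [h.1]
  have hzβ : z ^ (β : ℂ) ≠ 0 := by simp [Complex.cpow_eq_zero_iff, hz0]
  have hC : (C₂ : ℂ) ≠ 0 := by exact_mod_cast hC₂.ne'
  have hwa : (1 / z) ^ (a : ℂ) = z ^ (α : ℂ) / z ^ (β : ℂ) := by
    rw [one_div, Complex.inv_cpow _ _ harg, ha_def, Complex.ofReal_sub, Complex.cpow_sub _ _ hz0,
      inv_div]
  have hwb : (1 / z) ^ (β : ℂ) = (z ^ (β : ℂ))⁻¹ := by
    rw [one_div, Complex.inv_cpow _ _ harg]
  have hden : (1 : ℂ) - -((c : ℂ) * (1 / z) ^ (a : ℂ)) ≠ 0 := by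
    intro h
    rw [sub_eq_zero] at h
    rw [← h] at hq
    simp at hq
  have hfac : (C₁ : ℂ) * z ^ (α : ℂ) + (C₂ : ℂ) * z ^ (β : ℂ)
      = C₂ * z ^ (β : ℂ) * (1 - -((c : ℂ) * (1 / z) ^ (a : ℂ))) := by
    rw [hwa, hc_def, Complex.ofReal_div]
    field_simp
    ring
  constructor
  · rw [← hF, ← htsum]
    simp_rw [hval]
    rw [tsum_mul_left, tsum_geometric_of_norm_lt_one hq, hfac, hwb]
    field_simp
  · rw [hfac]
    exact mul_ne_zero (mul_ne_zero hC hzβ) hden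

lemma aux_unique (V L : Measure ℝ) [IsFiniteMeasure V] {g : ℝ → ℝ} (hg : Measurable g)
    (hgi : Integrable g L)
    (h : ∀ t : ℝ, ∫ x, Complex.exp (t * x * I) ∂V
      = ∫ x, (g x : ℂ) * Complex.exp (t * x * I) ∂L) :
    V = L.withDensity (fun x => ENNReal.ofReal (g x)) := by
  set P := L.withDensity (fun x => ENNReal.ofReal (g x)) with hP
  set N := L.withDensity (fun x => ENNReal.ofReal (-g x)) with hN
  have hPf : IsFiniteMeasure P := isFiniteMeasure_withDensity_ofReal hgi.2
  have hNf : IsFiniteMeasure N := isFiniteMeasure_withDensity_ofReal hgi.neg.2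
  have hbd : ∀ t : ℝ, ∀ (μ : Measure ℝ) [IsFiniteMeasure μ],
      Integrable (fun x : ℝ => Complex.exp (t * x * I)) μ := by
    intro t μ _
    refine Integrable.of_bound (by fun_prop) 1 (Filter.Eventually.of_forall fun x => ?_)
    rw [← Complex.ofReal_mul, Complex.norm_exp_ofReal_mul_I]
  have hm1 : Measurable fun x => ENNReal.ofReal (g x) := by fun_prop
  have hm2 : Measurable fun x => ENNReal.ofReal (-g x) := by fun_prop
  have hVN : V + N = P := by
    apply Measure.ext_of_charFun
    funext t
    rw [charFun_apply_real, charFun_apply_real, integral_add_measure (hbd t V) (hbd t N), h]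
    have i1 := hbd t P
    have i2 := hbd t N
    rw [hP, integrable_withDensity_iff_integrable_smul' hm1 (by simp)] at i1
    rw [hN, integrable_withDensity_iff_integrable_smul' hm2 (by simp)] at i2
    rw [hP, hN, integral_withDensity_eq_integral_toReal_smul hm1 (by simp),
      integral_withDensity_eq_integral_toReal_smul hm2 (by simp), ← eq_sub_iff_add_eq,
      ← integral_sub i1 i2]
    refine integral_congr_ae (Filter.Eventually.of_forall fun x => ?_)
    simp only [ENNReal.toReal_ofReal', Complex.real_smul]
    rcases le_total 0 (g x) with h0 | h0
    · rw [max_eq_left h0, max_eq_right (by linarith)]; simp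
    · rw [max_eq_right h0, max_eq_left (by linarith)]; simp
  have hN0 : N = 0 := by
    rw [← Measure.measure_univ_eq_zero]
    have hS : MeasurableSet {x | g x < 0} := measurableSet_lt hg measurable_const
    have e1 : P {x | g x < 0} = 0 := by
      rw [hP, withDensity_apply _ hS]
      refine (setLIntegral_congr_fun hS (g := 0) fun x hx => ?_).trans (by simp)
      exact ENNReal.ofReal_of_nonpos (le_of_lt hx)
    have e2 : N {x | g x < 0} = 0 := by
      rw [← hVN, Measure.add_apply] at e1
      exact (add_eq_zero.1 e1).2
    have e3 : N {x | g x < 0}ᶜ = 0 := by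
      rw [hN, withDensity_apply _ hS.compl]
      refine (setLIntegral_congr_fun hS.compl (g := 0) fun x hx => ?_).trans (by simp)
      have : ¬ g x < 0 := hx
      exact ENNReal.ofReal_of_nonpos (by linarith)
    rw [← measure_add_measure_compl hS, e2, e3, add_zero]
  rw [hN0, add_zero] at hVN
  exact hVN

/-- Explicit potential density for `Φ(z) = C₁ z^α + C₂ z^β`: the potential measure `U`
(characterized by its Laplace transform `1/Φ`) has on `(0,∞)` the continuous density
`u(x) = (x^{β-1}/C₂) E_{β-α,β}(-C₁ x^{β-α}/C₂)`. -/
theorem potential_density_sum_two_stable (α β C₁ C₂ : ℝ)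
    (hα : 0 ≤ α) (hαβ : α < β) (hβ : β ≤ 1) (hC₁ : 0 < C₁) (hC₂ : 0 < C₂)
    (U : Measure ℝ) [IsLocallyFiniteMeasure U]
    (hsupp : U (Set.Iio 0) = 0)
    (hLap : ∀ z : ℂ, 0 < z.re →
      ∫ x in Set.Ici (0 : ℝ), Complex.exp (-z * x) ∂U
        = 1 / ((C₁ : ℂ) * z ^ (α : ℂ) + (C₂ : ℂ) * z ^ (β : ℂ))) :
    ContinuousOn
      (fun x : ℝ => x ^ (β - 1) / C₂ * mittagLeffler2 (β - α) β (-(C₁ * x ^ (β - α) / C₂)))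
      (Set.Ioi 0) ∧
    ∀ s : Set ℝ, MeasurableSet s → s ⊆ Set.Ioi 0 →
      U s = ∫⁻ x in s,
        ENNReal.ofReal
          (x ^ (β - 1) / C₂ * mittagLeffler2 (β - α) β (-(C₁ * x ^ (β - α) / C₂))) := by
  have hβ0 : 0 < β := lt_of_le_of_lt hα hαβ
  have ha : 0 < β - α := by linarith
  have hML := aux_continuous ha hβ0
  set u : ℝ → ℝ := fun x => x ^ (β - 1) / C₂ *
    mittagLeffler2 (β - α) β (-(C₁ * x ^ (β - α) / C₂)) with hu
  have humeas : Measurable u := by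
    have : Measurable fun x : ℝ => mittagLeffler2 (β - α) β (-(C₁ * x ^ (β - α) / C₂)) :=
      hML.measurable.comp (by fun_prop)
    rw [hu]
    fun_prop
  constructor
  · have h1 : ∀ p : ℝ, ContinuousOn (fun x : ℝ => x ^ p) (Set.Ioi 0) := fun p x hx =>
      (Real.continuousAt_rpow_const x p (Or.inl (ne_of_gt hx))).continuousWithinAt
    refine ContinuousOn.mul ((h1 _).div_const _) ?_
    exact hML.comp_continuousOn ((((continuousOn_const).mul (h1 _)).div_const _).neg)
  -- choose a large abscissa
  obtain ⟨s₀, hs₀, hs₁⟩ : ∃ s₀ : ℝ, 0 < s₀ ∧ C₁ / C₂ * (1 / s₀) ^ (β - α) < 1 := by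
    set r : ℝ := (C₂ / C₁ / 2) ^ (1 / (β - α)) with hr
    have hrpos : 0 < r := by positivity
    refine ⟨1 / r, by positivity, ?_⟩
    rw [one_div_one_div, hr, ← Real.rpow_mul (by positivity), one_div, inv_mul_cancel₀ ha.ne',
      Real.rpow_one]
    have : C₁ / C₂ * (C₂ / C₁ / 2) = 1 / 2 := by field_simp
    rw [this]; norm_num
  have hre : ∀ t : ℝ, ((s₀ : ℂ) - t * I).re = s₀ := by intro t; simp
  have hlap : ∀ t : ℝ, _ := fun t => aux_laplace (z := (s₀ : ℂ) - t * I) hβ0 hαβ hC₁ hC₂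
    (by rw [hre]; exact hs₀) (by rw [hre]; exact hs₁)
  have hLapt : ∀ t : ℝ, _ := fun t => hLap ((s₀ : ℂ) - t * I) (by rw [hre]; exact hs₀)
  have hz0 : (s₀ : ℂ) - ((0 : ℝ) : ℂ) * I = s₀ := by simp
  have hexp : ∀ (t x : ℝ), Complex.exp (-((s₀ : ℂ) - t * I) * x)
      = (Real.exp (-(s₀ * x)) : ℂ) * Complex.exp (t * x * I) := by
    intro t x
    push_cast
    rw [← Complex.exp_add]
    congr 1
    ring
  have hUi : Integrable (fun x : ℝ => Real.exp (-(s₀ * x))) (U.restrict (Set.Ici 0)) := by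
    have h0 := hLapt 0
    have : Integrable (fun x : ℝ => Complex.exp (-((s₀ : ℂ) - ((0 : ℝ) : ℂ) * I) * x))
        (U.restrict (Set.Ici 0)) := by
      by_contra hcon
      rw [integral_undef hcon] at h0
      exact one_div_ne_zero (hlap 0).2 h0.symm
    refine this.norm.congr (Filter.Eventually.of_forall fun x => ?_)
    simp [Complex.norm_exp]
  have hui : Integrable (fun x : ℝ => Real.exp (-(s₀ * x)) * u x)
      (volume.restrict (Set.Ioi 0)) := by
    have h0 := (hlap 0).1
    have : Integrable (fun x : ℝ => (u x : ℂ) *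
        Complex.exp (-((s₀ : ℂ) - ((0 : ℝ) : ℂ) * I) * x)) (volume.restrict (Set.Ioi 0)) := by
      by_contra hcon
      rw [integral_undef hcon] at h0
      exact one_div_ne_zero (hlap 0).2 h0.symm
    refine this.re.congr (Filter.Eventually.of_forall fun x => ?_)
    simp only [hexp]
    simp only [Complex.ofReal_zero, zero_mul, Complex.exp_zero, mul_one]
    rw [← Complex.ofReal_mul, mul_comm (Real.exp _)]
    exact Complex.ofReal_re _
  have hpm : Measurable fun x : ℝ => ENNReal.ofReal (Real.exp (-(s₀ * x))) := by fun_prop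
  have hfin : IsFiniteMeasure ((U.restrict (Set.Ici 0)).withDensity
      (fun x : ℝ => ENNReal.ofReal (Real.exp (-(s₀ * x))))) :=
    isFiniteMeasure_withDensity_ofReal hUi.2
  have huniq := aux_unique ((U.restrict (Set.Ici 0)).withDensity
      (fun x : ℝ => ENNReal.ofReal (Real.exp (-(s₀ * x))))) (volume.restrict (Set.Ioi 0))
      (g := fun x => Real.exp (-(s₀ * x)) * u x) (by fun_prop) hui (by
    intro t
    rw [integral_withDensity_eq_integral_toReal_smul hpm (by simp)]
    have e1 := hLapt t
    rw [← (hlap t).1] at e1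
    simp only [hexp] at e1
    refine Eq.trans ?_ (e1.trans ?_)
    · congr 1
      funext x
      rw [ENNReal.toReal_ofReal (Real.exp_pos _).le, Complex.real_smul]
    · congr 1
      funext x
      rw [Complex.ofReal_mul (Real.exp _) (u x), mul_comm ((Real.exp (-(s₀ * x)) : ℝ) : ℂ) (u x : ℂ)]
      exact (mul_assoc _ _ _).symm)
  have hsplit : (fun x => ENNReal.ofReal (Real.exp (-(s₀ * x)) * u x))
      = (fun x => ENNReal.ofReal (u x)) * fun x => ENNReal.ofReal (Real.exp (-(s₀ * x))) := by
    funext x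
    rw [Pi.mul_apply, ENNReal.ofReal_mul (Real.exp_pos _).le, mul_comm]
  rw [hsplit, withDensity_mul _ (by fun_prop) hpm] at huniq
  have hfinal : U.restrict (Set.Ici 0) =
      (volume.restrict (Set.Ioi 0)).withDensity (fun x => ENNReal.ofReal (u x)) := by
    have hne : ∀ x : ℝ, ENNReal.ofReal (Real.exp (-(s₀ * x))) ≠ 0 := fun x => by
      simp [Real.exp_pos]
    rw [← withDensity_inv_same (μ := U.restrict (Set.Ici 0)) hpm
      (Filter.Eventually.of_forall hne) (by simp), huniq,
      withDensity_inv_same hpm (Filter.Eventually.of_forall hne) (by simp)]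
  intro s hs hs0
  have hsI : s ⊆ Set.Ici 0 := hs0.trans Set.Ioi_subset_Ici_self
  calc U s = U.restrict (Set.Ici 0) s := by
        rw [Measure.restrict_apply hs, Set.inter_eq_left.2 hsI]
    _ = _ := by
        rw [hfinal, withDensity_apply _ hs, Measure.restrict_restrict hs,
          Set.inter_eq_left.2 hs0]
end

section
/- Let 0 < a < 2 and b > 0. Then for every n ∈ ℕ ∪ {0}, the two-parameter Mittag-Leffler function satisfies E_{a,b}(-x) = Σ_{k=1}^{n+1} ((-1)^{k-1} x^{-k})/Γ(-ka+b) + O(x^{-(n+2)}) as x → +∞, where 1/Γ is the entire reciprocal Gamma function (so terms with -ka+b a nonpositive integer vanish). -/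
open Filter Asymptotics

namespace MLaux
open MeasureTheory Topology Complex

lemma integrable_exp_abs (c : ℝ) (hc : 0 < c) : Integrable (fun t : ℝ => Real.exp (-c * |t|)) := by
  rw [← integrableOn_univ, ← Set.Iic_union_Ioi (a := (0:ℝ)), integrableOn_union]
  constructor
  · refine (integrableOn_exp_mul_Iic hc 0).congr_fun ?_ measurableSet_Iic
    intro t ht
    simp only [Set.mem_Iic] at ht
    simp [abs_of_nonpos ht]
  · refine (integrableOn_exp_mul_Ioi (a := -c) (by linarith) 0).congr_fun ?_ measurableSet_Ioi
    intro t ht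
    simp only [Set.mem_Ioi] at ht
    simp [abs_of_pos ht]

lemma cosh_ge (y : ℝ) : Real.exp |y| / 2 ≤ Real.cosh y := by
  rw [← Real.cosh_abs, Real.cosh_eq]
  have := Real.exp_pos (-|y|)
  linarith

/-- weight integrability -/
lemma bound_weight {β : ℝ} (t C : ℝ) (z : ℂ) (hz : ‖z‖ ≤ C * Real.exp (β * |t|)) :
    ‖z / ((Real.cosh (Real.pi * t) : ℝ) : ℂ)‖ ≤ 2 * C * Real.exp (-(Real.pi - β) * |t|) := by
  have h1 := cosh_ge (Real.pi * t)
  rw [abs_mul, abs_of_pos Real.pi_pos] at h1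
  have hc := Real.cosh_pos (Real.pi * t)
  rw [norm_div, Complex.norm_real, Real.norm_of_nonneg hc.le, div_le_iff₀ hc]
  refine hz.trans ?_
  have hC : 0 ≤ C := by
    by_contra h
    push Not at h
    have := mul_neg_of_neg_of_pos h (Real.exp_pos (β * |t|))
    linarith [norm_nonneg z]
  calc C * Real.exp (β * |t|) = 2 * C * Real.exp (-(Real.pi - β) * |t|) * (Real.exp (Real.pi * |t|) / 2) := by
        have : Real.exp (β * |t|) = Real.exp (-(Real.pi - β) * |t|) * (Real.exp (Real.pi * |t|)) := by
          rw [← Real.exp_add]; ring_nf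
        rw [this]; ring
    _ ≤ _ := by gcongr

lemma integrable_weight {β C : ℝ} (hβ : β < Real.pi) (g : ℝ → ℂ) (hg : Continuous g)
    (hb : ∀ t, ‖g t‖ ≤ C * Real.exp (β * |t|)) :
    Integrable (fun t => g t / ((Real.cosh (Real.pi * t) : ℝ) : ℂ)) := by
  refine Integrable.mono' ((integrable_exp_abs (Real.pi - β) (by linarith)).const_mul (2 * C)) ?_ ?_
  · refine Continuous.aestronglyMeasurable ?_
    refine hg.div ?_ ?_
    · have := Real.continuous_cosh
      fun_prop
    · intro t
      exact_mod_cast (Real.cosh_pos (Real.pi * t)).ne'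
  · exact Eventually.of_forall fun t => bound_weight t C _ (hb t)

lemma integral_sech : ∫ t : ℝ, (1 : ℂ) / ((Real.cosh (Real.pi * t) : ℝ) : ℂ) = 1 := by
  have hi : Integrable (fun t : ℝ => (1:ℂ) / ((Real.cosh (Real.pi * t) : ℝ) : ℂ)) :=
    integrable_weight (β := 0) (C := 1) Real.pi_pos (fun _ => 1) continuous_const (by simp)
  have hi' : Integrable (fun t : ℝ => 1 / Real.cosh (Real.pi * t)) := by
    have := hi.re
    refine this.congr (Eventually.of_forall fun t => ?_)
    simp only [RCLike.re_to_complex]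
    rw [← Complex.ofReal_one, ← Complex.ofReal_div, Complex.ofReal_re]
  have key : ∫ t : ℝ, 1 / Real.cosh (Real.pi * t) = 1 := by
    have := integral_of_hasDerivAt_of_tendsto (f := fun t => 2 / Real.pi * Real.arctan (Real.exp (Real.pi * t)))
      (f' := fun t => 1 / Real.cosh (Real.pi * t)) (m := 2 / Real.pi * 0) (n := 2 / Real.pi * (Real.pi / 2)) ?_ hi' ?_ ?_
    · rw [this]; field_simp; ring
    · intro t
      have h1 : HasDerivAt (fun t : ℝ => Real.exp (Real.pi * t)) (Real.exp (Real.pi * t) * (Real.pi * 1)) t :=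
        ((hasDerivAt_id t).const_mul Real.pi).exp
      have h2 := (h1.arctan).const_mul (2 / Real.pi)
      refine h2.congr_deriv ?_
      rw [Real.cosh_eq, Real.exp_neg]
      have := Real.exp_pos (Real.pi * t)
      have := Real.pi_pos
      field_simp
      ring
    · refine Tendsto.const_mul _ ?_
      rw [← Real.arctan_zero]
      refine (Real.continuous_arctan.tendsto 0).comp ?_
      exact Real.tendsto_exp_atBot.comp (tendsto_id.const_mul_atBot Real.pi_pos)
    · refine Tendsto.const_mul _ ?_
      refine (Real.tendsto_arctan_atTop.mono_right nhdsWithin_le_nhds).comp ?_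
      exact Real.tendsto_exp_atTop.comp (tendsto_id.const_mul_atTop Real.pi_pos)
  have : ∀ t : ℝ, (1 : ℂ) / ((Real.cosh (Real.pi * t) : ℝ) : ℂ) = ((1 / Real.cosh (Real.pi * t) : ℝ) : ℂ) := by
    intro t; push_cast; rfl
  simp_rw [this]
  rw [integral_complex_ofReal, key]; simp

lemma norm_sin_ge (z : ℂ) : (Real.exp |z.im| - 1) / 2 ≤ ‖Complex.sin z‖ := by
  have h : ‖Complex.sin z‖ = ‖Complex.exp (-z * I) - Complex.exp (z * I)‖ / 2 := by
    rw [Complex.sin]; simp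
  rw [h]
  have e1 : ‖Complex.exp (-z * I)‖ = Real.exp z.im := by rw [Complex.norm_exp]; simp
  have e2 : ‖Complex.exp (z * I)‖ = Real.exp (-z.im) := by rw [Complex.norm_exp]; simp
  have h1 := norm_sub_norm_le (Complex.exp (-z * I)) (Complex.exp (z * I))
  have h2 := norm_sub_norm_le (Complex.exp (z * I)) (Complex.exp (-z * I))
  rw [norm_sub_rev] at h2
  rw [e1, e2] at h1 h2
  rcases le_total 0 z.im with hz | hz
  · rw [abs_of_nonneg hz]
    have : Real.exp (-z.im) ≤ 1 := Real.exp_le_one_iff.2 (by linarith)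
    linarith
  · rw [abs_of_nonpos hz]
    have : Real.exp (z.im) ≤ 1 := Real.exp_le_one_iff.2 (by linarith)
    linarith

lemma lemmaA {β C : ℝ} (hβ0 : 0 ≤ β) (hβ : β < Real.pi) (h : ℂ → ℂ) (hd : Differentiable ℂ h)
    (hb : ∀ z : ℂ, |z.re| ≤ 1/2 → ‖h z‖ ≤ C * Real.exp (β * |z.im|)) :
    (∫ t : ℝ, h ((1/2 : ℝ) + t * I) / ((Real.cosh (Real.pi * t) : ℝ) : ℂ)) +
    (∫ t : ℝ, h ((-1/2 : ℝ) + t * I) / ((Real.cosh (Real.pi * t) : ℝ) : ℂ)) = 2 * h 0 := by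
  have hC : 0 ≤ C := by simpa using (norm_nonneg _).trans (hb 0 (by simp))
  have h0 : ‖h 0‖ ≤ C := by simpa using hb 0 (by simp)
  set S : ℂ → ℂ := fun z => Complex.sin (Real.pi * z) with hS
  have hSd : Differentiable ℂ S := by
    intro z
    simp only [hS]
    fun_prop
  have hdsl : ∀ f : ℂ → ℂ, Differentiable ℂ f → Differentiable ℂ (dslope f 0) := by
    intro f hf
    rw [← differentiableOn_univ] at hf ⊢
    exact (Complex.differentiableOn_dslope (by simp)).2 hf
  have hSne : ∀ z : ℂ, |z.re| ≤ 1/2 → dslope S 0 z ≠ 0 := by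
    intro z hz
    by_cases hz0 : z = 0
    · rw [hz0, dslope_same]
      have : HasDerivAt S (Complex.cos (Real.pi * 0) * (Real.pi * 1)) 0 :=
        ((hasDerivAt_id (0:ℂ)).const_mul (Real.pi : ℂ)).csin
      rw [this.deriv]
      simp [Real.pi_ne_zero]
    · rw [dslope_of_ne _ hz0, slope_def_field]
      simp only [hS, mul_zero, Complex.sin_zero, sub_zero]
      refine div_ne_zero ?_ hz0
      intro hs
      obtain ⟨k, hk⟩ := Complex.sin_eq_zero_iff.1 hs
      have hk' : z = k := by
        have : (Real.pi : ℂ) ≠ 0 := by exact_mod_cast Real.pi_ne_zero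
        apply mul_left_cancel₀ this
        rw [hk]; ring
      have hk0 : k ≠ 0 := by
        rintro rfl
        simp at hk'
        exact hz0 hk'
      have : (1:ℝ) ≤ |(k:ℝ)| := by exact_mod_cast Int.one_le_abs hk0
      rw [hk'] at hz
      simp at hz
      linarith
  set f : ℂ → ℂ := fun z => dslope h 0 z / dslope S 0 z with hf
  have hfeq : ∀ z : ℂ, z ≠ 0 → f z = (h z - h 0) / S z := by
    intro z hz
    simp only [hf]
    rw [dslope_of_ne _ hz, dslope_of_ne _ hz, slope_def_field, slope_def_field]
    have : S 0 = 0 := by simp [hS]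
    rw [this]
    simp only [sub_zero]
    rw [div_div_div_cancel_right₀ hz]
  have hrect : ∀ T : ℝ, 
      (∫ x : ℝ in (-1/2)..(1/2), f (x + (-T : ℝ) * I)) - (∫ x : ℝ in (-1/2)..(1/2), f (x + T * I)) +
      I • (∫ y : ℝ in (-T)..T, f ((1/2:ℝ) + y * I)) -
      I • (∫ y : ℝ in (-T)..T, f ((-1/2:ℝ) + y * I)) = 0 := by
    intro T
    have := Complex.integral_boundary_rect_eq_zero_of_differentiableOn f ⟨-1/2, -T⟩ ⟨1/2, T⟩ ?_
    · exact this
    · intro z hz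
      have hz1 : |z.re| ≤ 1/2 := by
        have := hz.1
        simp only [Set.mem_preimage] at this
        rw [Set.uIcc_of_le (by norm_num)] at this
        rw [abs_le]; constructor <;> linarith [this.1, this.2]
      exact (((hdsl h hd) z).div ((hdsl S hSd) z) (hSne z hz1)).differentiableWithinAt
  have hv1 : ∀ t : ℝ, f ((1/2:ℝ) + t * I) = 
      h ((1/2 : ℝ) + t * I) / ((Real.cosh (Real.pi * t) : ℝ) : ℂ) - h 0 * (1 / ((Real.cosh (Real.pi * t) : ℝ) : ℂ)) := by
    intro t
    rw [hfeq]
    · have : S ((1/2:ℝ) + t * I) = ((Real.cosh (Real.pi * t) : ℝ) : ℂ) := by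
        simp only [hS]
        have : (Real.pi : ℂ) * ((1/2:ℝ) + t * I) = (Real.pi * t : ℂ) * I + Real.pi / 2 := by push_cast; ring
        rw [this, Complex.sin_add_pi_div_two, Complex.cos_mul_I]
        push_cast; rfl
      rw [this]; ring
    · intro h
      have := congrArg Complex.re h
      simp at this
  have hv2 : ∀ t : ℝ, f ((-1/2:ℝ) + t * I) = 
      -(h ((-1/2 : ℝ) + t * I) / ((Real.cosh (Real.pi * t) : ℝ) : ℂ) - h 0 * (1 / ((Real.cosh (Real.pi * t) : ℝ) : ℂ))) := by
    intro t
    rw [hfeq]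
    · have : S ((-1/2:ℝ) + t * I) = -((Real.cosh (Real.pi * t) : ℝ) : ℂ) := by
        simp only [hS]
        have : (Real.pi : ℂ) * ((-1/2:ℝ) + t * I) = (Real.pi * t : ℂ) * I - Real.pi / 2 := by push_cast; ring
        rw [this, Complex.sin_sub_pi_div_two, Complex.cos_mul_I]
        push_cast; rfl
      rw [this, div_neg]; ring
    · intro h
      have := congrArg Complex.re h
      simp at this
  -- integrability
  have hcont : ∀ c : ℝ, Continuous (fun t : ℝ => h (c + t * I)) := by
    intro c
    exact hd.continuous.comp (by fun_prop)
  have i1 : Integrable (fun t : ℝ => h ((1/2 : ℝ) + t * I) / ((Real.cosh (Real.pi * t) : ℝ) : ℂ)) := by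
    refine integrable_weight (C := C) hβ _ (hcont _) fun t => ?_
    have := hb ((1/2 : ℝ) + t * I) (by simp [abs_of_pos])
    simpa using this
  have i2 : Integrable (fun t : ℝ => h ((-1/2 : ℝ) + t * I) / ((Real.cosh (Real.pi * t) : ℝ) : ℂ)) := by
    refine integrable_weight (C := C) hβ _ (hcont _) fun t => ?_
    have := hb ((-1/2 : ℝ) + t * I) (by simp; norm_num [abs_of_pos, abs_div])
    simpa using this
  have i0 : Integrable (fun t : ℝ => h 0 * ((1:ℂ) / ((Real.cosh (Real.pi * t) : ℝ) : ℂ))) :=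
    (integrable_weight (β := 0) (C := 1) Real.pi_pos (fun _ => 1) continuous_const (by simp)).const_mul _
  -- limits
  have l1 : Tendsto (fun T : ℝ => ∫ y : ℝ in (-T)..T, f ((1/2:ℝ) + y * I)) atTop
      (𝓝 ((∫ t : ℝ, h ((1/2 : ℝ) + t * I) / ((Real.cosh (Real.pi * t) : ℝ) : ℂ)) - h 0)) := by
    have := intervalIntegral_tendsto_integral (i1.sub i0) tendsto_neg_atTop_atBot tendsto_id
    rw [integral_sub' i1 i0, integral_const_mul, integral_sech, mul_one] at this
    refine this.congr fun T => ?_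
    simp_rw [hv1]
    rfl
  have l2 : Tendsto (fun T : ℝ => ∫ y : ℝ in (-T)..T, f ((-1/2:ℝ) + y * I)) atTop
      (𝓝 (-((∫ t : ℝ, h ((-1/2 : ℝ) + t * I) / ((Real.cosh (Real.pi * t) : ℝ) : ℂ)) - h 0))) := by
    have := intervalIntegral_tendsto_integral (i2.sub i0) tendsto_neg_atTop_atBot tendsto_id
    rw [integral_sub' i2 i0, integral_const_mul, integral_sech, mul_one] at this
    refine this.neg.congr fun T => ?_
    simp_rw [hv2]
    rw [intervalIntegral.integral_neg]
    rfl
  have hbd : ∀ T : ℝ, 1 ≤ |T| → ∀ x ∈ Set.uIoc (-1/2 : ℝ) (1/2), ‖f (x + T * I)‖ ≤ 8 * C * Real.exp (-(Real.pi - β) * |T|) := by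
    intro T hT x hx
    rw [Set.uIoc_of_le (by norm_num)] at hx
    have hne : ((x:ℂ) + T * I) ≠ 0 := by
      intro h
      have := congrArg Complex.im h
      simp at this
      rw [this] at hT; norm_num at hT
    rw [hfeq _ hne, norm_div]
    have hp := Real.pi_gt_three
    have hs := norm_sin_ge (Real.pi * (x + T * I))
    have him : (Real.pi * ((x:ℂ) + T * I)).im = Real.pi * T := by simp
    rw [him, abs_mul, abs_of_pos Real.pi_pos] at hs
    have hs2 : Real.exp (Real.pi * |T|) / 4 ≤ ‖S (x + T * I)‖ := by
      refine le_trans ?_ hs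
      have : (2:ℝ) ≤ Real.exp (Real.pi * |T|) := by
        have := Real.add_one_le_exp (Real.pi * |T|)
        nlinarith
      linarith
    have hn : ‖h (x + T * I) - h 0‖ ≤ 2 * C * Real.exp (β * |T|) := by
      have a1 := hb (x + T * I) (by simp; rw [abs_le]; constructor <;> linarith [hx.1, hx.2])
      have a2 := norm_sub_le (h (x + T * I)) (h 0)
      have a3 : 1 ≤ Real.exp (β * |T|) := Real.one_le_exp (by positivity)
      simp at a1
      nlinarith
    have hpos : 0 < ‖S (x + T * I)‖ := lt_of_lt_of_le (by positivity) hs2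
    rw [div_le_iff₀ hpos]
    refine hn.trans ?_
    calc 2 * C * Real.exp (β * |T|) = 8 * C * Real.exp (-(Real.pi - β) * |T|) * (Real.exp (Real.pi * |T|) / 4) := by
          have : Real.exp (β * |T|) = Real.exp (-(Real.pi - β) * |T|) * (Real.exp (Real.pi * |T|)) := by
            rw [← Real.exp_add]; ring_nf
          rw [this]; ring
      _ ≤ _ := by gcongr
  have lexp : Tendsto (fun T : ℝ => 8 * C * Real.exp (-(Real.pi - β) * |T|) * |1/2 - (-1/2)|) atTop (𝓝 0) := by
    have : Tendsto (fun T : ℝ => Real.exp (-(Real.pi - β) * |T|)) atTop (𝓝 0) := by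
      refine Real.tendsto_exp_atBot.comp ?_
      exact (tendsto_abs_atTop_atTop).const_mul_atTop_of_neg (by linarith)
    simpa using (this.const_mul (8 * C)).mul_const (|1/2 - (-1/2)| : ℝ)
  have l3 : Tendsto (fun T : ℝ => ∫ x : ℝ in (-1/2)..(1/2), f (x + T * I)) atTop (𝓝 0) := by
    refine squeeze_zero_norm' ?_ lexp
    filter_upwards [eventually_ge_atTop 1] with T hT
    exact intervalIntegral.norm_integral_le_of_norm_le_const (hbd T (by rwa [abs_of_pos (by linarith)]))
  have l4 : Tendsto (fun T : ℝ => ∫ x : ℝ in (-1/2)..(1/2), f (x + (-T : ℝ) * I)) atTop (𝓝 0) := by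
    refine squeeze_zero_norm' ?_ lexp
    filter_upwards [eventually_ge_atTop 1] with T hT
    have := intervalIntegral.norm_integral_le_of_norm_le_const (hbd (-T) (by rwa [abs_neg, abs_of_pos (by linarith)]))
    rw [abs_neg] at this
    exact this
  have lim := ((l4.sub l3).add (l1.const_smul I)).sub (l2.const_smul I)
  have lim2 := lim.congr hrect
  have := tendsto_nhds_unique lim2 tendsto_const_nhds
  simp only [smul_eq_mul] at this
  have h3 := congrArg (fun z => -I * z) this
  have hI : I * I = -1 := Complex.I_mul_I
  linear_combination h3 + ((∫ t : ℝ, h ((1/2 : ℝ) + t * I) / ((Real.cosh (Real.pi * t) : ℝ) : ℂ)) - h 0 + ((∫ t : ℝ, h ((-1/2 : ℝ) + t * I) / ((Real.cosh (Real.pi * t) : ℝ) : ℂ)) - h 0)) * hI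

lemma gamma_one_add_im (t : ℝ) : ‖(Complex.Gamma (1 + t * I))⁻¹‖ ≤ Real.exp (Real.pi / 2 * |t|) := by
  by_cases ht : t = 0
  · simp [ht]
  have hne : (t * I : ℂ) ≠ 0 := by simp [ht]
  have h1 : Complex.Gamma (1 + t * I) * Complex.Gamma (1 - t * I) = (t * I) * (Real.pi / Complex.sin (Real.pi * (t * I))) := by
    rw [← Complex.Gamma_mul_Gamma_one_sub, add_comm (1:ℂ), Complex.Gamma_add_one _ hne]; ring
  have h2 : Complex.Gamma (1 - t * I) = (starRingEnd ℂ) (Complex.Gamma (1 + t * I)) := by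
    rw [← Complex.Gamma_conj]; simp [sub_eq_add_neg]
  have h3 : ‖Complex.Gamma (1 + t * I)‖ ^ 2 = |t| * (Real.pi / |Real.sinh (Real.pi * t)|) := by
    have := congrArg norm h1
    rw [h2, norm_mul, RCLike.norm_conj] at this
    rw [sq, this]
    have : (Real.pi : ℂ) * (t * I) = ((Real.pi * t : ℝ) : ℂ) * I := by push_cast; ring
    rw [this, Complex.sin_mul_I, ← Complex.ofReal_sinh]
    rw [norm_mul, norm_div, norm_mul, norm_mul, Complex.norm_I, Complex.norm_real, Complex.norm_real, Complex.norm_real, mul_one, mul_one]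
    simp [abs_of_pos Real.pi_pos]
  -- sinh y ≤ y * exp y
  have h4 : |Real.sinh (Real.pi * t)| ≤ Real.pi * |t| * Real.exp (Real.pi * |t|) := by
    rw [Real.abs_sinh, abs_mul, abs_of_pos Real.pi_pos]
    set y := Real.pi * |t|
    have hy : 0 ≤ y := by positivity
    rw [Real.sinh_eq]
    have a1 := Real.add_one_le_exp (-(2*y))
    have a2 : Real.exp (-y) = Real.exp y * Real.exp (-(2*y)) := by rw [← Real.exp_add]; ring_nf
    rw [a2]
    nlinarith [Real.exp_pos y]
  have h5 : 0 < |Real.sinh (Real.pi * t)| := by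
    rw [abs_pos]
    intro h
    rw [Real.sinh_eq_zero] at h
    simp [Real.pi_ne_zero, ht] at h
  have h6 : 0 < ‖Complex.Gamma (1 + t * I)‖ := by
    have hp : 0 < |t| * (Real.pi / |Real.sinh (Real.pi * t)|) := by
      have := Real.pi_pos
      positivity
    rw [← h3] at hp
    by_contra h
    have : ‖Complex.Gamma (1 + t * I)‖ = 0 := le_antisymm (not_lt.1 h) (norm_nonneg _)
    rw [this] at hp; norm_num at hp
  rw [norm_inv]
  refine (pow_le_pow_iff_left₀ (by positivity) (by positivity) two_ne_zero).1 ?_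
  rw [inv_pow, h3, ← Real.exp_nat_mul]
  have : ((2:ℕ) : ℝ) * (Real.pi / 2 * |t|) = Real.pi * |t| := by push_cast; ring
  rw [this]
  have hp := Real.pi_pos
  have ht' : 0 < |t| := abs_pos.2 ht
  rw [inv_le_iff_one_le_mul₀ (by positivity)]
  have : Real.exp (Real.pi * |t|) * (|t| * (Real.pi / |Real.sinh (Real.pi * t)|)) = (Real.pi * |t| * Real.exp (Real.pi * |t|)) / |Real.sinh (Real.pi * t)| := by ring

  rw [this, one_le_div h5]; exact h4

lemma gamma_ne (σ t : ℝ) (hσ : 0 < σ) : Complex.Gamma (σ + t * I) ≠ 0 :=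
  Complex.Gamma_ne_zero_of_re_pos (by simpa using hσ)

lemma gamma_bound1 (σ t : ℝ) (hσ : 1 ≤ σ) :
    ‖(Complex.Gamma (σ + t * I))⁻¹‖ ≤ (Real.Gamma σ)⁻¹ * Real.exp (Real.pi / 2 * |t|) := by
  have hseq : ∀ n : ℕ, 1 ≤ n → ‖Complex.GammaSeq σ n‖ * ‖Complex.GammaSeq (1 + t * I) n‖ ≤
      ‖Complex.GammaSeq (σ + t * I) n‖ * ‖Complex.GammaSeq 1 n‖ := by
    intro n hn
    have hn' : (0:ℝ) < n := by exact_mod_cast hn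
    have hnorm : ∀ s : ℂ, ‖(n:ℂ) ^ s‖ = (n:ℝ) ^ s.re := by
      intro s
      have := Complex.norm_cpow_eq_rpow_re_of_pos hn' s
      simpa using this
    simp only [Complex.GammaSeq, norm_div, norm_mul, hnorm, norm_prod]
    simp only [ofReal_re, add_re, one_re, mul_re, I_re, mul_zero, ofReal_im, I_im, mul_one, sub_self, add_zero]
    have hpos : ∀ (s : ℝ), 0 < s → ∀ u : ℝ, ∀ j : ℕ, 0 < ‖((s:ℂ) + u * I + j)‖ := by
      intro s hs u j
      rw [norm_pos_iff]
      intro h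
      have := congrArg Complex.re h
      simp at this
      have hj : (0:ℝ) ≤ j := by positivity
      linarith
    have P : ∀ (s : ℝ), 0 < s → ∀ u : ℝ, 0 < ∏ j ∈ Finset.range (n+1), ‖((s:ℂ) + u * I + j)‖ :=
      fun s hs u => Finset.prod_pos fun j _ => hpos s hs u j
    have p1 := P σ (by linarith) 0
    have p2 := P σ (by linarith) t
    have p3 := P 1 (by linarith) 0
    have p4 := P 1 (by linarith) t
    simp only [ofReal_zero, zero_mul, add_zero, ofReal_one] at p1 p2 p3 p4
    rw [div_mul_div_comm, div_mul_div_comm]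
    refine div_le_div_of_nonneg_left (by positivity) (by positivity) ?_ 
    rw [← Finset.prod_mul_distrib, ← Finset.prod_mul_distrib]
    refine Finset.prod_le_prod (fun j _ => by positivity) fun j _ => ?_
    refine (pow_le_pow_iff_left₀ (by positivity) (by positivity) two_ne_zero).1 ?_
    rw [mul_pow, mul_pow]
    simp only [← Complex.normSq_eq_norm_sq, Complex.normSq_apply]
    simp
    have hj : (0:ℝ) ≤ j := by positivity
    have e1 : (1 + (j:ℝ)) * (1 + j) ≤ (σ + j) * (σ + j) := by nlinarith
    nlinarith [mul_self_nonneg t]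
  have L : ∀ s : ℂ, Tendsto (fun n => ‖Complex.GammaSeq s n‖) atTop (𝓝 ‖Complex.Gamma s‖) :=
    fun s => (Complex.GammaSeq_tendsto_Gamma s).norm
  have lim := le_of_tendsto_of_tendsto ((L σ).mul (L (1 + t * I))) ((L (σ + t * I)).mul (L 1))
    (by filter_upwards [eventually_ge_atTop 1] with n hn using hseq n hn)
  rw [Complex.Gamma_one, norm_one, mul_one, Complex.Gamma_ofReal, Complex.norm_real,
    Real.norm_of_nonneg (Real.Gamma_nonneg_of_nonneg (by linarith))] at lim
  have g1 := gamma_one_add_im t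
  have n1 : 0 < ‖Complex.Gamma (σ + t * I)‖ := norm_pos_iff.2 (gamma_ne σ t (by linarith))
  have n2 : 0 < ‖Complex.Gamma (1 + t * I)‖ := norm_pos_iff.2 (by simpa using gamma_ne 1 t (by linarith))
  have n3 : 0 < Real.Gamma σ := Real.Gamma_pos_of_pos (by linarith)
  calc ‖(Complex.Gamma (σ + t * I))⁻¹‖ ≤ (Real.Gamma σ)⁻¹ * ‖(Complex.Gamma (1 + t * I))⁻¹‖ := by
        rw [norm_inv, norm_inv, ← mul_inv]
        exact inv_anti₀ (by positivity) lim
    _ ≤ _ := by gcongr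

lemma gamma_bound2 (γ : ℝ) (m : ℕ) : Real.pi / 2 < γ → ∀ R : ℝ, ∃ C : ℝ, 0 ≤ C ∧ ∀ z : ℂ, 1 - m ≤ z.re → z.re ≤ R →
    ‖(Complex.Gamma z)⁻¹‖ ≤ C * Real.exp (γ * |z.im|) := by
  induction m generalizing γ with
  | zero =>
    intro hγ R
    have hc : ContinuousOn (fun σ : ℝ => (Real.Gamma σ)⁻¹) (Set.Icc 1 R) := by
      intro σ hσ
      refine ContinuousAt.continuousWithinAt ?_
      refine ContinuousAt.inv₀ ?_ (Real.Gamma_pos_of_pos (by linarith [hσ.1])).ne'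
      refine (Real.differentiableAt_Gamma fun m => ?_).continuousAt
      have : (0:ℝ) ≤ m := by positivity
      linarith [hσ.1]
    obtain ⟨C, hC⟩ := isCompact_Icc.exists_bound_of_continuousOn hc
    refine ⟨max C 0, le_max_right _ _, fun z h1 h2 => ?_⟩
    simp only [Nat.cast_zero, sub_zero] at h1
    have := gamma_bound1 z.re z.im h1
    rw [Complex.re_add_im] at this
    refine this.trans ?_
    have h3 := (le_abs_self _).trans (hC z.re ⟨h1, h2⟩)
    gcongr
    exact h3.trans (le_max_left _ _)
  | succ m ih =>
    intro hγ R
    obtain ⟨C, hC0, hC⟩ := ih ((Real.pi/2 + γ)/2) (by linarith) (R + 1)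
    set δ := γ - (Real.pi/2 + γ)/2 with hδ
    have hδ0 : 0 < δ := by linarith
    refine ⟨(|R| + m + 1 / δ) * C, by positivity, fun z h1 h2 => ?_⟩
    rw [Complex.one_div_Gamma_eq_self_mul_one_div_Gamma_add_one, norm_mul]
    push_cast at h1
    have h3 := hC (z + 1) (by simp; linarith) (by simp; linarith)
    simp only [add_im, one_im, add_zero] at h3
    have h4 : ‖z‖ ≤ (|R| + m + 1 / δ) * Real.exp (δ * |z.im|) := by
      refine (Complex.norm_le_abs_re_add_abs_im z).trans ?_
      have b1 : |z.re| ≤ |R| + m := by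
        rw [abs_le]; constructor
        · linarith [abs_nonneg R]
        · have : (0:ℝ) ≤ m := by positivity
          linarith [le_abs_self R]
      have b2 : 1 ≤ Real.exp (δ * |z.im|) := Real.one_le_exp (by positivity)
      have b3 : δ * |z.im| ≤ Real.exp (δ * |z.im|) := by linarith [Real.add_one_le_exp (δ * |z.im|)]
      have b4 : |z.im| ≤ 1 / δ * Real.exp (δ * |z.im|) := by
        rw [one_div, ← div_eq_inv_mul, le_div_iff₀ hδ0]; linarith
      have b5 : |R| + m ≤ (|R| + m) * Real.exp (δ * |z.im|) := le_mul_of_one_le_right (by positivity) b2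
      linarith
    calc ‖z‖ * ‖(Complex.Gamma (z + 1))⁻¹‖ ≤ ((|R| + m + 1 / δ) * Real.exp (δ * |z.im|)) * (C * Real.exp ((Real.pi/2 + γ)/2 * |z.im|)) := by gcongr
      _ = (|R| + m + 1 / δ) * C * (Real.exp (δ * |z.im|) * Real.exp ((Real.pi/2 + γ)/2 * |z.im|)) := by ring
      _ = _ := by rw [← Real.exp_add, hδ]; ring_nf

lemma gamma_lower (T y : ℝ) (hT : 0 < T) (hy : 1 ≤ y) : T ^ (y - 1) * Real.exp (-T) ≤ Real.Gamma y := by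
  rw [Real.Gamma_eq_integral (by linarith)]
  have hconv := Real.GammaIntegral_convergent (s := y) (by linarith)
  have h1 : ∫ x in Set.Ioi T, Real.exp (-x) * x ^ (y - 1) ≤ ∫ x in Set.Ioi 0, Real.exp (-x) * x ^ (y - 1) := by
    refine setIntegral_mono_set hconv ?_ (Set.Ioi_subset_Ioi hT.le).eventuallyLE
    refine (ae_restrict_iff' measurableSet_Ioi).2 (Eventually.of_forall fun x hx => ?_)
    have : (0:ℝ) < x := hx
    simp only [Pi.zero_apply]; positivity
  refine le_trans ?_ h1
  have h2 : ∫ x in Set.Ioi T, Real.exp (-x) * T ^ (y - 1) = T ^ (y - 1) * Real.exp (-T) := by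
    rw [integral_mul_const, integral_exp_neg_Ioi]; ring
  rw [← h2]
  refine setIntegral_mono_on ((integrableOn_exp_neg_Ioi T).mul_const _) (hconv.mono_set (Set.Ioi_subset_Ioi hT.le)) measurableSet_Ioi fun x hx => ?_
  have : T < x := hx
  have := Real.rpow_le_rpow hT.le this.le (by linarith : 0 ≤ y - 1)
  gcongr


noncomputable def G (a b x : ℝ) (s : ℂ) : ℂ :=
  Complex.exp (-(Real.log x : ℂ) * s) * (Complex.Gamma (b - a * s))⁻¹

noncomputable def J (a b x : ℝ) (c : ℝ) : ℂ :=
  ∫ t : ℝ, G a b x (c + t * I) / ((Real.cosh (Real.pi * t) : ℝ) : ℂ)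

lemma G_diff (a b x : ℝ) : Differentiable ℂ (G a b x) := by
  unfold G
  refine Differentiable.mul (by fun_prop) ?_
  exact Complex.differentiable_one_div_Gamma.comp (f := fun s : ℂ => (b:ℂ) - a * s) (by fun_prop)

lemma G_norm (a b x : ℝ) (s : ℂ) :
    ‖G a b x s‖ = Real.exp (-Real.log x * s.re) * ‖(Complex.Gamma (b - a * s))⁻¹‖ := by
  rw [G, norm_mul, Complex.norm_exp]; simp

lemma G_real (a b x r : ℝ) (hx : 0 < x) :
    G a b x r = ((x ^ (-r) / Real.Gamma (-r * a + b) : ℝ) : ℂ) := by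
  rw [G, Real.rpow_def_of_pos hx]
  have : (b : ℂ) - a * r = ((-r * a + b : ℝ) : ℂ) := by push_cast; ring
  rw [this, Complex.Gamma_ofReal]
  push_cast
  rw [div_eq_mul_inv]
  congr 2
  ring

lemma int_bound (β : ℝ) (hβ : β < Real.pi) : ∃ K : ℝ, 0 ≤ K ∧ ∀ (C : ℝ) (g : ℝ → ℂ),
    (∀ t, ‖g t‖ ≤ C * Real.exp (β * |t|)) →
    ‖∫ t : ℝ, g t / ((Real.cosh (Real.pi * t) : ℝ) : ℂ)‖ ≤ C * K := by
  refine ⟨2 * ∫ t : ℝ, Real.exp (-(Real.pi - β) * |t|), ?_, fun C g hg => ?_⟩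
  · have : 0 ≤ ∫ t : ℝ, Real.exp (-(Real.pi - β) * |t|) := integral_nonneg fun t => (Real.exp_pos _).le
    positivity
  · have hi := (integrable_exp_abs (Real.pi - β) (by linarith)).const_mul (2 * C)
    have := norm_integral_le_of_norm_le hi (Eventually.of_forall fun t => bound_weight t C _ (hg t))
    refine this.trans (le_of_eq ?_)
    rw [integral_const_mul]; ring

/-- bound in a vertical strip -/
lemma strip_bound (a b : ℝ) (ha0 : 0 < a) (ha2 : a < 2) : ∃ β : ℝ, 0 ≤ β ∧ β < Real.pi ∧ ∀ R : ℝ, 0 ≤ R →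
    ∃ C : ℝ, 0 ≤ C ∧ ∀ s : ℂ, |s.re| ≤ R →
      ‖(Complex.Gamma (b - a * s))⁻¹‖ ≤ C * Real.exp (β * |s.im|) := by
  have hp := Real.pi_pos
  set γ : ℝ := (Real.pi / 2 + Real.pi / a) / 2 with hγ
  have h1 : Real.pi / 2 < Real.pi / a := div_lt_div_of_pos_left hp ha0 ha2
  have hγ1 : Real.pi / 2 < γ := by linarith
  have hγ2 : γ < Real.pi / a := by linarith
  refine ⟨γ * a, by positivity, (lt_div_iff₀ ha0).1 hγ2, fun R hR => ?_⟩
  obtain ⟨m, hm⟩ := exists_nat_ge (1 - b + a * R)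
  obtain ⟨C, hC0, hC⟩ := gamma_bound2 γ m hγ1 (b + a * R)
  refine ⟨C, hC0, fun s hs => ?_⟩
  have hs' := abs_le.1 hs
  have := hC (b - a * s) (by simp; nlinarith) (by simp; nlinarith)
  have him : |((b:ℂ) - a * s).im| = a * |s.im| := by
    simp [abs_mul, abs_of_pos ha0]
  rw [him] at this
  refine this.trans (le_of_eq ?_)
  ring_nf

lemma J_rec (a b x : ℝ) (ha0 : 0 < a) (ha2 : a < 2) (c : ℝ) :
    J a b x (c + 1/2) + J a b x (c - 1/2) = 2 * G a b x c := by
  obtain ⟨β, hβ0, hβ, hR⟩ := strip_bound a b ha0 ha2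
  obtain ⟨C, hC0, hC⟩ := hR (|c| + 1/2) (by positivity)
  have := lemmaA (C := Real.exp (|Real.log x| * (|c| + 1/2)) * C) hβ0 hβ (fun z => G a b x (c + z))
    ((G_diff a b x).comp (by fun_prop)) ?_
  · simp only [add_zero] at this
    rw [← this, J, J]
    congr 2
    · ext t; congr 2; push_cast; ring
    · ext t; congr 2; push_cast; ring
  · intro z hz
    have hre : |((c:ℂ) + z).re| ≤ |c| + 1/2 := by
      simp only [add_re, ofReal_re]
      exact (abs_add_le _ _).trans (by linarith)
    rw [G_norm, mul_assoc]
    have h2 := hC (c + z) hre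
    simp only [add_im, ofReal_im, zero_add] at h2
    refine mul_le_mul (Real.exp_le_exp.2 ?_) h2 (norm_nonneg _) (Real.exp_pos _).le
    refine (le_abs_self _).trans ?_
    rw [abs_mul, abs_neg]
    gcongr

lemma J_bound (a b : ℝ) (ha0 : 0 < a) (ha2 : a < 2) (c : ℝ) :
    ∃ K : ℝ, 0 ≤ K ∧ ∀ x : ℝ, 0 < x → ‖J a b x c‖ ≤ K * x ^ (-c) := by
  obtain ⟨β, hβ0, hβ, hR⟩ := strip_bound a b ha0 ha2
  obtain ⟨C, hC0, hC⟩ := hR |c| (by positivity)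
  obtain ⟨K, hK0, hK⟩ := int_bound β hβ
  refine ⟨C * K, by positivity, fun x hx => ?_⟩
  have := hK (x ^ (-c) * C) (fun t => G a b x (c + t * I)) ?_
  · rw [J]
    refine this.trans (le_of_eq ?_); ring
  · intro t
    rw [G_norm, mul_assoc, Real.rpow_def_of_pos hx]
    have h2 := hC (c + t * I) (by simp)
    simp only [add_im, ofReal_im, zero_add, mul_im, I_im, mul_one, ofReal_re, I_re, mul_zero, add_zero] at h2
    refine mul_le_mul (Real.exp_le_exp.2 (le_of_eq ?_)) h2 (norm_nonneg _) (Real.exp_pos _).le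
    simp

lemma gamma_geom (a c x : ℝ) (ha0 : 0 < a) (hx : 0 < x) : ∃ D : ℝ, ∀ N : ℕ, 1 ≤ N * a + c →
    x ^ N * (Real.Gamma (N * a + c))⁻¹ ≤ D * (1/2 : ℝ) ^ N := by
  set T : ℝ := (2 * x) ^ (1 / a) with hT
  have hT0 : 0 < T := by positivity
  refine ⟨(T ^ (c - 1))⁻¹ * Real.exp T, fun N hN => ?_⟩
  have h1 := gamma_lower T (N * a + c) hT0 hN
  have h2 : T ^ ((N:ℝ) * a + c - 1) = (2 * x) ^ N * T ^ (c - 1) := by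
    rw [show (N:ℝ) * a + c - 1 = a * N + (c - 1) by ring, Real.rpow_add hT0, Real.rpow_mul hT0.le]
    have h3 : T ^ a = 2 * x := by
      rw [hT, ← Real.rpow_mul (by positivity), one_div_mul_cancel ha0.ne', Real.rpow_one]
    rw [h3, Real.rpow_natCast]
  rw [h2] at h1
  have h3 : 0 < (2 * x) ^ N * T ^ (c - 1) * Real.exp (-T) := by positivity
  calc x ^ N * (Real.Gamma (N * a + c))⁻¹ ≤ x ^ N * ((2 * x) ^ N * T ^ (c - 1) * Real.exp (-T))⁻¹ := by
        gcongr
    _ = _ := by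
        rw [mul_inv, mul_inv, mul_pow, mul_inv, Real.exp_neg, inv_inv, one_div, inv_pow]
        have : x ^ N ≠ 0 := by positivity
        field_simp

lemma ev_ge (a c : ℝ) (ha0 : 0 < a) : ∀ᶠ N : ℕ in atTop, 1 ≤ (N:ℝ) * a + c := by
  have : Tendsto (fun N : ℕ => (N:ℝ) * a + c) atTop atTop :=
    tendsto_atTop_add_const_right _ _ (tendsto_natCast_atTop_atTop.atTop_mul_const ha0)
  exact this.eventually_ge_atTop 1

lemma J_tendsto (a b x : ℝ) (ha0 : 0 < a) (ha2 : a < 2) (hx : 0 < x) :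
    Tendsto (fun N : ℕ => J a b x (1/2 - N)) atTop (𝓝 0) := by
  have hp := Real.pi_pos
  obtain ⟨K, hK0, hK⟩ := int_bound (Real.pi / 2 * a) (by nlinarith)
  obtain ⟨D, hD⟩ := gamma_geom a (b - a / 2) x ha0 hx
  have hlim : Tendsto (fun N : ℕ => x ^ (-(1/2) : ℝ) * (D * (1/2:ℝ) ^ N) * K) atTop (𝓝 0) := by
    have := tendsto_pow_atTop_nhds_zero_of_lt_one (r := (1/2:ℝ)) (by norm_num) (by norm_num)
    simpa using ((this.const_mul D).const_mul (x ^ (-(1/2) : ℝ))).mul_const K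
  refine squeeze_zero_norm' ?_ hlim
  filter_upwards [ev_ge a (b - a/2) ha0] with N hN
  refine hK _ (fun t => G a b x ((1/2 - N : ℝ) + t * I)) fun t => ?_
  rw [G_norm]
  have h1 := gamma_bound1 (N * a + (b - a/2)) (-a * t) hN
  have h2 : (b:ℂ) - a * ((1/2 - N : ℝ) + t * I) = ((N * a + (b - a/2) : ℝ) : ℂ) + ((-a * t : ℝ) : ℂ) * I := by
    push_cast; ring
  rw [h2]
  have h3 : Real.exp (-Real.log x * (((1/2 - N : ℝ) : ℂ) + t * I).re) = x ^ (-(1/2) : ℝ) * x ^ N := by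
    rw [← Real.rpow_natCast, ← Real.rpow_add hx, Real.rpow_def_of_pos hx]
    congr 1
    simp
    ring
  rw [h3]
  calc x ^ (-(1/2) : ℝ) * x ^ N * ‖(Complex.Gamma (((N * a + (b - a/2) : ℝ) : ℂ) + ((-a * t : ℝ) : ℂ) * I))⁻¹‖
      ≤ x ^ (-(1/2) : ℝ) * x ^ N * ((Real.Gamma (N * a + (b - a/2)))⁻¹ * Real.exp (Real.pi / 2 * |-a * t|)) := by gcongr
    _ = x ^ (-(1/2) : ℝ) * (x ^ N * (Real.Gamma (N * a + (b - a/2)))⁻¹) * Real.exp (Real.pi / 2 * a * |t|) := by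
        rw [abs_mul, abs_neg, abs_of_pos ha0]; ring_nf
    _ ≤ _ := by
        refine mul_le_mul_of_nonneg_right ?_ (Real.exp_pos _).le
        exact mul_le_mul_of_nonneg_left (hD N hN) (by positivity)

lemma ml_summable (a b x : ℝ) (ha0 : 0 < a) (hx : 0 < x) :
    Summable (fun k : ℕ => (-x) ^ k / Real.Gamma (k * a + b)) := by
  obtain ⟨D, hD⟩ := gamma_geom a b x ha0 hx
  refine Summable.of_norm_bounded_eventually_nat (g := fun k => D * (1/2:ℝ) ^ k)
    ((summable_geometric_of_lt_one (by norm_num) (by norm_num)).mul_left D) ?_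
  filter_upwards [ev_ge a b ha0] with N hN
  rw [norm_div, norm_pow, norm_neg, Real.norm_of_nonneg hx.le,
    Real.norm_of_nonneg (Real.Gamma_nonneg_of_nonneg (by linarith)), div_eq_mul_inv]
  exact hD N hN

lemma ml_eq_J (a b x : ℝ) (ha0 : 0 < a) (ha2 : a < 2) (hx : 0 < x) :
    2 * ((mittagLeffler2 a b (-x) : ℝ) : ℂ) = J a b x (1/2) := by
  have hpart : ∀ N : ℕ, 2 * ((∑ k ∈ Finset.range N, (-x) ^ k / Real.Gamma (k * a + b) : ℝ) : ℂ)
      = J a b x (1/2) - (-1) ^ N * J a b x (1/2 - N) := by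
    intro N
    induction N with
    | zero => simp
    | succ N ih =>
      rw [Finset.sum_range_succ, ofReal_add, mul_add, ih]
      have h1 := J_rec a b x ha0 ha2 (-(N:ℝ))
      rw [G_real a b x _ hx] at h1
      have e1 : -(N:ℝ) + 1/2 = 1/2 - N := by ring
      have e2 : -(N:ℝ) - 1/2 = 1/2 - ((N+1 : ℕ) : ℝ) := by push_cast; ring
      rw [e1, e2, neg_neg, Real.rpow_natCast] at h1
      have e3 : (((-x) ^ N / Real.Gamma (N * a + b) : ℝ) : ℂ) = (-1) ^ N * ((x ^ N / Real.Gamma (N * a + b) : ℝ) : ℂ) := by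
        rw [neg_pow]; push_cast; ring
      rw [e3, pow_succ]
      linear_combination (-(-1:ℂ) ^ N) * h1
  have hs := (ml_summable a b x ha0 hx).hasSum.tendsto_sum_nat
  have l1 : Tendsto (fun N : ℕ => 2 * ((∑ k ∈ Finset.range N, (-x) ^ k / Real.Gamma (k * a + b) : ℝ) : ℂ)) atTop
      (𝓝 (2 * ((mittagLeffler2 a b (-x) : ℝ) : ℂ))) :=
    (((Complex.continuous_ofReal.tendsto _).comp hs)).const_mul 2
  have l2 : Tendsto (fun N : ℕ => J a b x (1/2) - (-1) ^ N * J a b x (1/2 - N)) atTop (𝓝 (J a b x (1/2))) := by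
    have : Tendsto (fun N : ℕ => (-1 : ℂ) ^ N * J a b x (1/2 - N)) atTop (𝓝 0) := by
      rw [tendsto_zero_iff_norm_tendsto_zero]
      have := (J_tendsto a b x ha0 ha2 hx).norm
      simpa using this
    simpa using tendsto_const_nhds.sub this
  exact tendsto_nhds_unique l1 (l2.congr fun N => (hpart N).symm)

lemma ml_expand (a b x : ℝ) (ha0 : 0 < a) (ha2 : a < 2) (hx : 0 < x) (M : ℕ) :
    2 * ((mittagLeffler2 a b (-x) - ∑ k ∈ Finset.Icc 1 M,
            (-1 : ℝ) ^ (k - 1) * x ^ (-(k : ℝ)) / Real.Gamma (-(k : ℝ) * a + b) : ℝ) : ℂ)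
      = (-1) ^ M * J a b x (M + 1/2) := by
  induction M with
  | zero => simpa using ml_eq_J a b x ha0 ha2 hx
  | succ M ih =>
    rw [Finset.sum_Icc_succ_top (by omega), ← sub_sub, ofReal_sub, mul_sub, ih]
    have h1 := J_rec a b x ha0 ha2 ((M+1 : ℕ) : ℝ)
    rw [G_real a b x _ hx] at h1
    have e1 : ((M+1 : ℕ) : ℝ) - 1/2 = M + 1/2 := by push_cast; ring
    rw [e1] at h1
    have e3 : (((-1:ℝ) ^ (M + 1 - 1) * x ^ (-((M+1 : ℕ) : ℝ)) / Real.Gamma (-((M+1 : ℕ) : ℝ) * a + b) : ℝ) : ℂ)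
        = (-1) ^ M * ((x ^ (-((M+1 : ℕ) : ℝ)) / Real.Gamma (-((M+1 : ℕ) : ℝ) * a + b) : ℝ) : ℂ) := by
      rw [Nat.add_sub_cancel, mul_div_assoc, ofReal_mul]; simp
    rw [e3, pow_succ]
    linear_combination ((-1:ℂ) ^ M) * h1

end MLaux

/-- Asymptotic expansion of `E_{a,b}(-x)` as `x → +∞` for `0 < a < 2`, `b > 0`:
`E_{a,b}(-x) = Σ_{k=1}^{n+1} (-1)^{k-1} x^{-k} / Γ(-ka+b) + O(x^{-(n+2)})`. -/
theorem mittagLeffler2_asymptotic (a b : ℝ) (ha0 : 0 < a) (ha2 : a < 2) (hb : 0 < b)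
    (n : ℕ) :
    (fun x : ℝ =>
        mittagLeffler2 a b (-x) -
          ∑ k ∈ Finset.Icc 1 (n + 1),
            (-1 : ℝ) ^ (k - 1) * x ^ (-(k : ℝ)) / Real.Gamma (-(k : ℝ) * a + b))
      =O[atTop] (fun x : ℝ => x ^ (-((n : ℝ) + 2))) := by
  obtain ⟨K, hK0, hK⟩ := MLaux.J_bound a b ha0 ha2 (((n + 2 : ℕ) : ℝ) + 1/2)
  set A : ℝ := |(Real.Gamma (-((n + 2 : ℕ) : ℝ) * a + b))⁻¹| with hA
  refine IsBigO.of_bound (K / 2 + A) ?_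
  filter_upwards [eventually_ge_atTop 1] with x hx
  have hx0 : 0 < x := by linarith
  have h1 := MLaux.ml_expand a b x ha0 ha2 hx0 (n + 2)
  have h2 := hK x hx0
  rw [show n + 2 = (n + 1) + 1 from rfl, Finset.sum_Icc_succ_top (by omega), ← sub_sub] at h1
  set D : ℝ := mittagLeffler2 a b (-x) - ∑ k ∈ Finset.Icc 1 (n + 1),
            (-1 : ℝ) ^ (k - 1) * x ^ (-(k : ℝ)) / Real.Gamma (-(k : ℝ) * a + b) with hD
  set t : ℝ := (-1 : ℝ) ^ (n + 1 + 1 - 1) * x ^ (-((n + 1 + 1 : ℕ) : ℝ)) / Real.Gamma (-((n + 1 + 1 : ℕ) : ℝ) * a + b) with ht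
  have e : x ^ (-((n + 1 + 1 : ℕ) : ℝ)) = x ^ (-((n : ℝ) + 2)) := by
    congr 1; push_cast; ring
  have hpos : 0 < x ^ (-((n : ℝ) + 2)) := by positivity
  have ht' : |t| = A * x ^ (-((n : ℝ) + 2)) := by
    rw [ht, e, abs_div, abs_mul, abs_pow, abs_neg, abs_one, one_pow, one_mul, abs_of_pos hpos, hA, abs_inv, div_eq_inv_mul]
  have h3 : 2 * |D - t| ≤ K * x ^ (-((n : ℝ) + 2)) := by
    have := congrArg norm h1
    rw [norm_mul, norm_mul, norm_pow, norm_neg, norm_one, one_pow, one_mul, Complex.norm_real, Real.norm_eq_abs] at this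
    simp only [Complex.norm_ofNat] at this
    rw [this]
    refine h2.trans ?_
    refine mul_le_mul_of_nonneg_left (Real.rpow_le_rpow_of_exponent_le hx ?_) hK0
    push_cast; linarith
  have h4 : |D| ≤ |D - t| + |t| := by
    have := abs_add_le (D - t) t
    simpa using this
  rw [Real.norm_eq_abs, Real.norm_of_nonneg hpos.le]
  rw [ht'] at h4
  nlinarith
end

section
/- Let 0 < α ≤ 1 and n ∈ ℕ ∪ {0}. Then ∫_x^{∞} (α E_α(-t^α)/t) dt = Σ_{ℓ=1}^{n+1} ((-1)^{ℓ-1} x^{-ℓα})/(ℓ Γ(-ℓα + 1)) + O(x^{-(n+2)α}) as x → +∞, where E_α(z) = Σ_{k=0}^∞ z^k/Γ(kα+1) is the Mittag-Leffler function and 1/Γ is the entire reciprocal Gamma function. -/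
open Filter Asymptotics MeasureTheory

namespace GST
open Complex Set Topology

/-- Hankel-type contour integral in logarithmic coordinates. -/
noncomputable def J (G : ℂ → ℂ) (c : ℝ) : ℂ :=
  (∫ u in Ioi c, (G ((u : ℂ) + (Real.pi : ℂ) * I) - G ((u : ℂ) - (Real.pi : ℂ) * I))) +
    I * ∫ θ in (-Real.pi)..Real.pi, G ((c : ℂ) + (θ : ℂ) * I)

/-- The basic integrand. -/
noncomputable def E (b : ℝ) (w : ℂ) : ℂ := cexp (cexp w - b * w)

structure Good (G : ℂ → ℂ) : Prop where
  diff : ∀ w : ℂ, |w.im| ≤ Real.pi → DifferentiableAt ℂ G w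
  intp : ∀ c : ℝ, IntegrableOn (fun u : ℝ => G ((u : ℂ) + (Real.pi : ℂ) * I)) (Ioi c)
  intm : ∀ c : ℝ, IntegrableOn (fun u : ℝ => G ((u : ℂ) - (Real.pi : ℂ) * I)) (Ioi c)

lemma cont_vert {G : ℂ → ℂ} (hG : Good G) (c : ℝ) :
    IntervalIntegrable (fun θ : ℝ => G ((c : ℂ) + (θ : ℂ) * I)) volume (-Real.pi) Real.pi := by
  apply ContinuousOn.intervalIntegrable
  intro θ hθ
  rw [uIcc_of_le (by linarith [Real.pi_pos])] at hθ
  have h := (hG.diff ((c : ℂ) + (θ : ℂ) * I) (by simpa using abs_le.2 hθ)).continuousAt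
  have h2 : ContinuousAt (fun θ : ℝ => (c : ℂ) + (θ : ℂ) * I) θ := by fun_prop
  exact (ContinuousAt.comp (f := fun θ : ℝ => (c : ℂ) + (θ : ℂ) * I) h h2).continuousWithinAt

lemma cont_p {G : ℂ → ℂ} (hd : ∀ w : ℂ, |w.im| ≤ Real.pi → DifferentiableAt ℂ G w) :
    Continuous (fun u : ℝ => G ((u : ℂ) + (Real.pi : ℂ) * I)) := by
  rw [continuous_iff_continuousAt]
  intro u
  have h := (hd ((u : ℂ) + (Real.pi : ℂ) * I) (by simp [abs_of_pos Real.pi_pos])).continuousAt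
  have h2 : ContinuousAt (fun u : ℝ => (u : ℂ) + (Real.pi : ℂ) * I) u := by fun_prop
  exact ContinuousAt.comp (f := fun u : ℝ => (u : ℂ) + (Real.pi : ℂ) * I) h h2

lemma cont_m {G : ℂ → ℂ} (hd : ∀ w : ℂ, |w.im| ≤ Real.pi → DifferentiableAt ℂ G w) :
    Continuous (fun u : ℝ => G ((u : ℂ) - (Real.pi : ℂ) * I)) := by
  rw [continuous_iff_continuousAt]
  intro u
  have h := (hd ((u : ℂ) - (Real.pi : ℂ) * I) (by simp [abs_of_pos Real.pi_pos])).continuousAt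
  have h2 : ContinuousAt (fun u : ℝ => (u : ℂ) - (Real.pi : ℂ) * I) u := by fun_prop
  exact ContinuousAt.comp (f := fun u : ℝ => (u : ℂ) - (Real.pi : ℂ) * I) h h2

lemma exp_p (u : ℝ) : cexp ((u : ℂ) + (Real.pi : ℂ) * I) = -(Real.exp u : ℂ) := by
  rw [Complex.exp_add, Complex.exp_pi_mul_I]; simp

lemma exp_m (u : ℝ) : cexp ((u : ℂ) - (Real.pi : ℂ) * I) = -(Real.exp u : ℂ) := by
  rw [Complex.exp_sub, Complex.exp_pi_mul_I]; simp [div_neg]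

lemma norm_E (b : ℝ) (w : ℂ) : ‖E b w‖ = Real.exp ((cexp w).re - b * w.re) := by
  rw [E, Complex.norm_exp]; simp

lemma norm_E_p (b u : ℝ) :
    ‖E b ((u : ℂ) + (Real.pi : ℂ) * I)‖ = Real.exp (-Real.exp u - b * u) := by
  rw [norm_E, exp_p, ← ofReal_neg, ofReal_re]; simp

lemma norm_E_m (b u : ℝ) :
    ‖E b ((u : ℂ) - (Real.pi : ℂ) * I)‖ = Real.exp (-Real.exp u - b * u) := by
  rw [norm_E, exp_m, ← ofReal_neg, ofReal_re]; simp

lemma norm_E_v (b c θ : ℝ) :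
    ‖E b ((c : ℂ) + (θ : ℂ) * I)‖ ≤ Real.exp (Real.exp c - b * c) := by
  rw [norm_E]
  apply Real.exp_le_exp.2
  have := (Complex.abs_re_le_norm (cexp ((c : ℂ) + (θ : ℂ) * I)))
  rw [Complex.norm_exp] at this
  have h2 := le_abs_self (cexp ((c : ℂ) + (θ : ℂ) * I)).re
  simp at this h2 ⊢
  linarith

lemma tendsto_base (b : ℝ) :
    Tendsto (fun u : ℝ => Real.exp (-Real.exp u - b * u)) atTop (𝓝 0) := by
  have h := (tendsto_rpow_mul_exp_neg_mul_atTop_nhds_zero (-b) 1 one_pos).comp Real.tendsto_exp_atTop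
  refine h.congr fun u => ?_
  simp only [Function.comp]
  rw [← Real.exp_mul, ← Real.exp_add]
  ring_nf

lemma int_base (b c : ℝ) : IntegrableOn (fun u : ℝ => Real.exp (-Real.exp u - b * u)) (Ioi c) := by
  apply integrable_of_isBigO_exp_neg one_pos
  · fun_prop
  · have h := tendsto_base (b - 1)
    have h2 := h.isBigO_one ℝ
    have h3 := h2.mul (isBigO_refl (fun u : ℝ => Real.exp (-1 * u)) atTop)
    refine (h3.congr (fun u => ?_) (fun u => ?_))
    · rw [← Real.exp_add]; ring_nf
    · simp

/-- comparison -/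
lemma good_of_bound {G : ℂ → ℂ} (b : ℝ) {M : ℝ}
    (hd : ∀ w : ℂ, |w.im| ≤ Real.pi → DifferentiableAt ℂ G w)
    (hb : ∀ w : ℂ, |w.im| = Real.pi → ‖G w‖ ≤ M * ‖E b w‖) : Good G where
  diff := hd
  intp c := by
    refine Integrable.mono' ((int_base b c).const_mul M) (cont_p hd).aestronglyMeasurable ?_
    refine Eventually.of_forall fun u => ?_
    rw [← norm_E_p]
    exact hb _ (by simp [abs_of_pos Real.pi_pos])
  intm c := by
    refine Integrable.mono' ((int_base b c).const_mul M) (cont_m hd).aestronglyMeasurable ?_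
    refine Eventually.of_forall fun u => ?_
    rw [← norm_E_m]
    exact hb _ (by simp [abs_of_pos Real.pi_pos])

lemma good_E (b : ℝ) : Good (E b) :=
  good_of_bound b (M := 1) (fun w _ => by unfold E; fun_prop) (fun w _ => by simp)

lemma Good.add {G H : ℂ → ℂ} (hG : Good G) (hH : Good H) : Good (fun w => G w + H w) where
  diff w hw := (hG.diff w hw).add (hH.diff w hw)
  intp c := (hG.intp c).add (hH.intp c)
  intm c := (hG.intm c).add (hH.intm c)

lemma Good.const_mul {G : ℂ → ℂ} (hG : Good G) (a : ℂ) : Good (fun w => a * G w) where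
  diff w hw := (hG.diff w hw).const_mul a
  intp c := (hG.intp c).const_mul a
  intm c := (hG.intm c).const_mul a

lemma J_add {G H : ℂ → ℂ} (hG : Good G) (hH : Good H) (c : ℝ) :
    J (fun w => G w + H w) c = J G c + J H c := by
  unfold J
  rw [intervalIntegral.integral_add (cont_vert hG c) (cont_vert hH c),
    integral_sub ((hG.add hH).intp c) ((hG.add hH).intm c),
    integral_sub (hG.intp c) (hG.intm c), integral_sub (hH.intp c) (hH.intm c)]
  rw [integral_add (hG.intp c) (hH.intp c), integral_add (hG.intm c) (hH.intm c)]
  ring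

lemma J_const_mul (G : ℂ → ℂ) (a : ℂ) (c : ℝ) :
    J (fun w => a * G w) c = a * J G c := by
  unfold J
  simp_rw [← mul_sub]
  rw [intervalIntegral.integral_const_mul, integral_const_mul]
  ring

lemma good_sum {ι : Type*} (s : Finset ι) (a : ι → ℂ) (G : ι → ℂ → ℂ)
    (hG : ∀ i, Good (G i)) : Good (fun w => ∑ i ∈ s, a i * G i w) := by
  classical
  induction s using Finset.induction_on with
  | empty =>
    constructor <;> simp
  | insert i s hi ih =>
    simp_rw [Finset.sum_insert hi]
    exact ((hG i).const_mul _).add ih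

lemma J_sum {ι : Type*} (s : Finset ι) (a : ι → ℂ) (G : ι → ℂ → ℂ)
    (hG : ∀ i, Good (G i)) (c : ℝ) :
    J (fun w => ∑ i ∈ s, a i * G i w) c = ∑ i ∈ s, a i * J (G i) c := by
  classical
  induction s using Finset.induction_on with
  | empty => simp [J]
  | insert i s hi ih =>
    simp_rw [Finset.sum_insert hi]
    rw [J_add ((hG i).const_mul _) (good_sum s a G hG), J_const_mul, ih]

lemma J_bound (b c : ℝ) : ∃ K : ℝ, 0 ≤ K ∧ ∀ (G : ℂ → ℂ) (M : ℝ), 0 ≤ M →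
    (∀ w : ℂ, c ≤ w.re → |w.im| ≤ Real.pi → (w.re = c ∨ |w.im| = Real.pi) →
      ‖G w‖ ≤ M * ‖E b w‖) → ‖J G c‖ ≤ M * K := by
  refine ⟨(∫ u in Ioi c, 2 * Real.exp (-Real.exp u - b * u)) +
    Real.exp (Real.exp c - b * c) * (2 * Real.pi), ?_, ?_⟩
  · have : 0 ≤ ∫ u in Ioi c, 2 * Real.exp (-Real.exp u - b * u) :=
      integral_nonneg fun u => by positivity
    have := Real.pi_pos
    positivity
  intro G M hM h
  unfold J
  refine (norm_add_le _ _).trans ?_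
  rw [mul_add]
  refine add_le_add ?_ ?_
  · rw [← integral_const_mul]
    refine norm_integral_le_of_norm_le (((int_base b c).const_mul 2).const_mul M) ?_
    refine (ae_restrict_iff' measurableSet_Ioi).2 (Eventually.of_forall fun u hu => ?_)
    have hu' : c ≤ u := le_of_lt hu
    have h1 := h ((u : ℂ) + (Real.pi : ℂ) * I) (by simpa using hu')
      (by simp [abs_of_pos Real.pi_pos]) (by simp [abs_of_pos Real.pi_pos])
    have h2 := h ((u : ℂ) - (Real.pi : ℂ) * I) (by simpa using hu')
      (by simp [abs_of_pos Real.pi_pos]) (by simp [abs_of_pos Real.pi_pos])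
    rw [norm_E_p] at h1
    rw [norm_E_m] at h2
    refine (norm_sub_le _ _).trans ?_
    linarith
  · rw [norm_mul, Complex.norm_I, one_mul]
    have := intervalIntegral.norm_integral_le_of_norm_le_const
      (f := fun θ : ℝ => G ((c : ℂ) + (θ : ℂ) * I)) (a := -Real.pi) (b := Real.pi)
      (C := M * Real.exp (Real.exp c - b * c)) (by
        intro θ hθ
        rw [uIoc_of_le (by linarith [Real.pi_pos])] at hθ
        refine (h _ (by simp) (by simpa using abs_le.2 ⟨hθ.1.le, hθ.2⟩) (by simp)).trans ?_
        exact mul_le_mul_of_nonneg_left (norm_E_v b c θ) hM)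
    refine this.trans (le_of_eq ?_)
    rw [abs_of_pos (by linarith [Real.pi_pos])]
    ring

lemma J_indep {G : ℂ → ℂ} (hG : Good G) (c d : ℝ) : J G c = J G d := by
  have h := Complex.integral_boundary_rect_eq_zero_of_differentiableOn G
    ((c : ℂ) - (Real.pi : ℂ) * I) ((d : ℂ) + (Real.pi : ℂ) * I) (by
      intro w hw
      apply (hG.diff w ?_).differentiableWithinAt
      have := hw.2
      simp only [sub_im, add_im, ofReal_im, mul_im, ofReal_re, I_im, I_re, mem_preimage] at this
      rw [uIcc_of_le (by linarith [Real.pi_pos])] at this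
      exact abs_le.2 ⟨by linarith [this.1], by linarith [this.2]⟩)
  simp only [sub_im, add_im, ofReal_im, mul_im, ofReal_re, I_im, I_re, sub_re, add_re, mul_re] at h
  simp only [mul_zero, mul_one, sub_zero, add_zero, zero_sub, zero_add, ofReal_neg,
    neg_mul, ← sub_eq_add_neg, smul_eq_mul] at h
  unfold J
  rw [integral_sub (hG.intp c) (hG.intm c), integral_sub (hG.intp d) (hG.intm d),
    ← intervalIntegral.integral_interval_add_Ioi (hG.intp c) (hG.intp d),
    ← intervalIntegral.integral_interval_add_Ioi (hG.intm c) (hG.intm d)]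
  linear_combination -h

lemma tendsto_E_p (b : ℝ) :
    Tendsto (fun u : ℝ => E b ((u : ℂ) + (Real.pi : ℂ) * I)) atTop (𝓝 0) := by
  rw [tendsto_zero_iff_norm_tendsto_zero]
  simp_rw [norm_E_p]
  exact tendsto_base b

lemma tendsto_E_m (b : ℝ) :
    Tendsto (fun u : ℝ => E b ((u : ℂ) - (Real.pi : ℂ) * I)) atTop (𝓝 0) := by
  rw [tendsto_zero_iff_norm_tendsto_zero]
  simp_rw [norm_E_m]
  exact tendsto_base b

lemma deriv_E (b : ℝ) (w : ℂ) : HasDerivAt (E b) (E (b - 1) w + (-b : ℂ) * E b w) w := by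
  have h : HasDerivAt (fun w : ℂ => cexp w - b * w) (cexp w - b * 1) w :=
    (Complex.hasDerivAt_exp w).sub ((hasDerivAt_id w).const_mul (b : ℂ))
  have h2 := h.cexp
  refine h2.congr_deriv ?_
  unfold E
  have : cexp (cexp w - ((b - 1 : ℝ) : ℂ) * w) = cexp (cexp w - b * w) * cexp w := by
    rw [← Complex.exp_add]; push_cast; ring_nf
  rw [this]; ring

lemma J_E_rec (b c : ℝ) : J (E (b - 1)) c = b * J (E b) c := by
  have hD : Good (fun w => E (b - 1) w + (-b : ℂ) * E b w) :=
    (good_E (b - 1)).add ((good_E b).const_mul _)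
  have h0 : J (fun w => E (b - 1) w + (-b : ℂ) * E b w) c = 0 := by
    unfold J
    rw [integral_sub (hD.intp c) (hD.intm c)]
    rw [integral_Ioi_of_hasDerivAt_of_tendsto'
      (f := fun u : ℝ => E b ((u : ℂ) + (Real.pi : ℂ) * I)) (m := 0) ?_ (hD.intp c) (tendsto_E_p b)]
    rw [integral_Ioi_of_hasDerivAt_of_tendsto'
      (f := fun u : ℝ => E b ((u : ℂ) - (Real.pi : ℂ) * I)) (m := 0) ?_ (hD.intm c) (tendsto_E_m b)]
    · rw [← intervalIntegral.integral_const_mul,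
        intervalIntegral.integral_eq_sub_of_hasDerivAt
        (f := fun θ : ℝ => E b ((c : ℂ) + (θ : ℂ) * I))]
      · push_cast; ring_nf
      · intro θ _
        have h1 : HasDerivAt (fun z : ℂ => (c : ℂ) + z * I) (1 * I) (θ : ℂ) :=
          ((hasDerivAt_id _).mul_const I).const_add _
        have h2 := (HasDerivAt.comp (θ : ℂ) (deriv_E b _) h1).comp_ofReal
        refine h2.congr_deriv ?_
        ring
      · exact (cont_vert hD c).const_mul I
    · intro u _
      have h1 : HasDerivAt (fun z : ℂ => z - (Real.pi : ℂ) * I) 1 (u : ℂ) :=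
          (hasDerivAt_id _).sub_const _
      have h2 := (HasDerivAt.comp (u : ℂ) (deriv_E b _) h1).comp_ofReal
      exact h2.congr_deriv (mul_one _)
    · intro u _
      have h1 : HasDerivAt (fun z : ℂ => z + (Real.pi : ℂ) * I) 1 (u : ℂ) :=
          (hasDerivAt_id _).add_const _
      have h2 := (HasDerivAt.comp (u : ℂ) (deriv_E b _) h1).comp_ofReal
      exact h2.congr_deriv (mul_one _)
  rw [J_add (good_E _) ((good_E b).const_mul _), J_const_mul] at h0
  linear_combination h0

lemma gamma_line {a : ℝ} (ha : 0 < a) :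
    Integrable (fun u : ℝ => Real.exp (-Real.exp u + a * u)) ∧
      ∫ u : ℝ, Real.exp (-Real.exp u + a * u) = Real.Gamma a := by
  have hd : ∀ x ∈ (univ : Set ℝ), HasDerivWithinAt Real.exp (Real.exp x) univ x :=
    fun x _ => (Real.hasDerivAt_exp x).hasDerivWithinAt
  have hi : InjOn Real.exp univ := Real.exp_injective.injOn
  have him : Real.exp '' univ = Ioi 0 := by rw [image_univ, Real.range_exp]
  have heq : ∀ u : ℝ, |Real.exp u| • (Real.exp (-Real.exp u) * Real.exp u ^ (a - 1)) =
      Real.exp (-Real.exp u + a * u) := by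
    intro u
    rw [abs_of_pos (Real.exp_pos u), smul_eq_mul, ← Real.exp_mul, ← Real.exp_add, ← Real.exp_add]
    ring_nf
  have h1 := (integrableOn_image_iff_integrableOn_abs_deriv_smul MeasurableSet.univ hd hi
    (fun x => Real.exp (-x) * x ^ (a - 1))).1 (by rw [him]; exact Real.GammaIntegral_convergent ha)
  have h2 := integral_image_eq_integral_abs_deriv_smul MeasurableSet.univ hd hi
    (fun x => Real.exp (-x) * x ^ (a - 1))
  rw [him, ← Real.Gamma_eq_integral ha] at h2
  simp only [heq, integrableOn_univ, Measure.restrict_univ] at h1 h2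
  exact ⟨h1, h2.symm⟩

lemma E_p (b u : ℝ) : E b ((u : ℂ) + (Real.pi : ℂ) * I) =
    (Real.exp (-Real.exp u - b * u) : ℂ) * cexp (-((Real.pi * b : ℝ) : ℂ) * I) := by
  rw [E, exp_p, ofReal_exp, ofReal_exp, ← Complex.exp_add]
  push_cast; ring_nf

lemma E_m (b u : ℝ) : E b ((u : ℂ) - (Real.pi : ℂ) * I) =
    (Real.exp (-Real.exp u - b * u) : ℂ) * cexp (((Real.pi * b : ℝ) : ℂ) * I) := by
  rw [E, exp_m, ofReal_exp, ofReal_exp, ← Complex.exp_add]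
  push_cast; ring_nf

lemma E_diff (b u : ℝ) :
    E b ((u : ℂ) + (Real.pi : ℂ) * I) - E b ((u : ℂ) - (Real.pi : ℂ) * I) =
    (-2 * I * (Real.sin (Real.pi * b) : ℂ)) * (Real.exp (-Real.exp u - b * u) : ℂ) := by
  rw [E_p, E_m, ofReal_sin, Complex.sin]
  linear_combination ((cexp (-((Real.pi * b : ℝ) : ℂ) * I) - cexp (((Real.pi * b : ℝ) : ℂ) * I)) *
    (Real.exp (-Real.exp u - b * u) : ℂ)) * I_mul_I

lemma J_E (b c : ℝ) : J (E b) c =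
    (-2 * I * (Real.sin (Real.pi * b) : ℂ)) *
      ((∫ u in Ioi c, Real.exp (-Real.exp u - b * u) : ℝ) : ℂ) +
    I * ∫ θ in (-Real.pi)..Real.pi, E b ((c : ℂ) + (θ : ℂ) * I) := by
  unfold J
  simp_rw [E_diff]
  rw [integral_const_mul, integral_complex_ofReal]

lemma J_E_neg {b : ℝ} (hb : b < 0) (c : ℝ) :
    J (E b) c = 2 * Real.pi * I * ((Real.Gamma (b + 1))⁻¹ : ℝ) := by
  have hval : J (E b) c = (-2 * I * (Real.sin (Real.pi * b) : ℂ)) * (Real.Gamma (-b) : ℂ) := by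
    have h1 : Tendsto (fun c : ℝ => J (E b) c) atBot (𝓝 (J (E b) c)) :=
      tendsto_const_nhds.congr fun d => J_indep (good_E b) c d
    refine tendsto_nhds_unique h1 ?_
    simp_rw [J_E]
    have hg := gamma_line (a := -b) (by linarith)
    have hint := AECover.integral_tendsto_of_countably_generated
      (aecover_Ioi (μ := (volume : Measure ℝ)) (a := fun c : ℝ => c) (l := atBot) tendsto_id) hg.1
    rw [hg.2] at hint
    have hv : Tendsto (fun c : ℝ => I * ∫ θ in (-Real.pi)..Real.pi, E b ((c : ℂ) + (θ : ℂ) * I))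
        atBot (𝓝 0) := by
      have hb' : Tendsto (fun c : ℝ => Real.exp (Real.exp c - b * c) * |Real.pi - -Real.pi|)
          atBot (𝓝 0) := by
        have : Tendsto (fun c : ℝ => Real.exp c - b * c) atBot atBot := by
          refine Tendsto.add_atBot (C := 0) Real.tendsto_exp_atBot ?_
          have := tendsto_id.const_mul_atBot (r := -b) (by linarith) (f := fun c : ℝ => c) (l := atBot)
          refine this.congr fun c => by ring
        simpa using (Real.tendsto_exp_atBot.comp this).mul_const |Real.pi - -Real.pi|
      refine squeeze_zero_norm (fun c => ?_) hb'
      rw [norm_mul, Complex.norm_I, one_mul]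
      exact intervalIntegral.norm_integral_le_of_norm_le_const fun θ _ => norm_E_v b c θ
    have := (((continuous_ofReal.tendsto _).comp hint).const_mul
      (-2 * I * (Real.sin (Real.pi * b) : ℂ))).add hv
    rw [add_zero] at this
    refine this.congr fun c => ?_
    simp only [Function.comp]
    congr 5
    ext u
    ring_nf
  rw [hval]
  have hr := Real.Gamma_mul_Gamma_one_sub (-b)
  have hG : Real.Gamma (-b) ≠ 0 := (Real.Gamma_pos_of_pos (by linarith)).ne'
  have hr2 : (Real.Gamma (b + 1))⁻¹ = Real.Gamma (-b) * (-Real.sin (Real.pi * b)) / Real.pi := by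
    have h3 : Real.Gamma (b + 1) = Real.pi / Real.sin (Real.pi * -b) / Real.Gamma (-b) := by
      rw [← hr]; field_simp; ring_nf
    rw [h3, inv_div, div_div_eq_mul_div, mul_neg, Real.sin_neg]
  rw [hr2]
  push_cast
  have : (Real.pi : ℂ) ≠ 0 := by exact_mod_cast Real.pi_ne_zero
  field_simp

lemma J_E_zero (c : ℝ) : J (E 0) c = 2 * Real.pi * I := by
  have h1 : Tendsto (fun c : ℝ => J (E 0) c) atBot (𝓝 (J (E 0) c)) :=
      tendsto_const_nhds.congr fun d => J_indep (good_E 0) c d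
  refine tendsto_nhds_unique h1 ?_
  simp_rw [J_E]
  have hv : Tendsto (fun c : ℝ => ∫ θ in (-Real.pi)..Real.pi, E 0 ((c : ℂ) + (θ : ℂ) * I))
        atBot (𝓝 (∫ θ in (-Real.pi)..Real.pi, (1 : ℂ))) := by
    refine intervalIntegral.tendsto_integral_filter_of_dominated_convergence (fun _ => Real.exp 1)
      ?_ ?_ ?_ ?_
    · refine Eventually.of_forall fun c => ?_
      apply Continuous.aestronglyMeasurable
      unfold E; fun_prop
    · filter_upwards [eventually_le_atBot 0] with c hc
      refine Eventually.of_forall fun θ _ => (norm_E_v 0 c θ).trans ?_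
      rw [zero_mul, sub_zero]
      exact Real.exp_le_exp.2 (Real.exp_le_one_iff.2 hc)
    · simp
    · refine Eventually.of_forall fun θ _ => ?_
      have h0 : Tendsto (fun c : ℝ => cexp ((c : ℂ) + (θ : ℂ) * I)) atBot (𝓝 0) := by
        rw [tendsto_zero_iff_norm_tendsto_zero]
        simp_rw [Complex.norm_exp]
        simpa using Real.tendsto_exp_atBot
      have := (Complex.continuous_exp.tendsto 0).comp h0
      rw [Complex.exp_zero] at this
      refine this.congr fun c => ?_
      simp [E]
  have := hv.const_mul I
  simp only [mul_zero, Real.sin_zero, ofReal_zero, zero_mul, zero_add]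
  convert this using 2
  rw [intervalIntegral.integral_const]
  simp
  ring

lemma J_E_val (b c : ℝ) : J (E b) c = 2 * Real.pi * I * ((Real.Gamma (b + 1))⁻¹ : ℝ) := by
  have key : ∀ n : ℕ, ∀ b : ℝ, b ≤ n →
      J (E b) c = 2 * Real.pi * I * ((Real.Gamma (b + 1))⁻¹ : ℝ) := by
    intro n
    induction n with
    | zero =>
      intro b hb
      rcases lt_or_eq_of_le hb with h | h
      · exact J_E_neg (by simpa using h) c
      · have : b = 0 := by simpa using h
        subst this
        rw [J_E_zero]; simp
    | succ n ih =>
      intro b hb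
      rcases lt_trichotomy b 0 with h | h | h
      · exact J_E_neg h c
      · subst h
        rw [J_E_zero]; simp
      · have h1 := ih (b - 1) (by push_cast at hb; linarith)
        rw [J_E_rec, sub_add_cancel] at h1
        have hbc : (b : ℂ) ≠ 0 := by exact_mod_cast h.ne'
        rw [Real.Gamma_add_one h.ne']
        apply mul_left_cancel₀ hbc
        rw [h1]
        push_cast
        rw [mul_inv]
        field_simp
  obtain ⟨n, hn⟩ := exists_nat_ge b
  exact key n b hn

/-- auxiliary variable -/
noncomputable def zz (α x : ℝ) (w : ℂ) : ℂ := (x : ℂ)⁻¹ * cexp (α * w)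

/-- integrand representing the Mittag-Leffler function -/
noncomputable def GG (α x : ℝ) (w : ℂ) : ℂ := cexp (cexp w) * (zz α x w / (1 + zz α x w))

lemma zz_ne {α x : ℝ} (hx : 0 < x) (w : ℂ) : zz α x w ≠ 0 := by
  unfold zz
  have : (x : ℂ) ≠ 0 := by exact_mod_cast hx.ne'
  exact mul_ne_zero (inv_ne_zero this) (Complex.exp_ne_zero _)

lemma norm_zz {α x : ℝ} (hx : 0 < x) (w : ℂ) : ‖zz α x w‖ = x⁻¹ * Real.exp (α * w.re) := by
  unfold zz
  rw [norm_mul, Complex.norm_exp, norm_inv, Complex.norm_real, Real.norm_of_nonneg hx.le]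
  simp

lemma one_add_zz_ne {α x : ℝ} (h0 : 0 < α) (h1 : α < 1) (hx : 0 < x) {w : ℂ}
    (hw : |w.im| ≤ Real.pi) : 1 + zz α x w ≠ 0 := by
  intro h
  have hre := congrArg Complex.re h
  have him := congrArg Complex.im h
  unfold zz at hre him
  rw [← ofReal_inv] at hre him
  simp only [add_re, one_re, re_ofReal_mul, Complex.exp_re, add_im, one_im, im_ofReal_mul,
    Complex.exp_im, zero_re, zero_im, zero_add] at hre him
  have hxi : 0 < x⁻¹ := inv_pos.2 hx
  have he := Real.exp_pos (α * w.re)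
  have hs : Real.sin (α * w.im) = 0 := by
    rcases mul_eq_zero.1 him with h | h
    · exact absurd h hxi.ne'
    · rcases mul_eq_zero.1 h with h | h
      · exact absurd h he.ne'
      · exact h
  have hlt : |α * w.im| < Real.pi := by
    rw [abs_mul, abs_of_pos h0]
    have := Real.pi_pos
    nlinarith [abs_nonneg w.im]
  rw [abs_lt] at hlt
  have h00 := (Real.sin_eq_zero_iff_of_lt_of_lt hlt.1 hlt.2).1 hs
  rw [h00, Real.cos_zero] at hre
  have : 0 < x⁻¹ * (Real.exp (α * w.re) * 1) := by positivity
  linarith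

lemma sin_le_norm {α x : ℝ} {w : ℂ} (hw : |w.im| = Real.pi) (h0 : 0 < α) (h1 : α < 1) :
    Real.sin (Real.pi * α) ≤ ‖1 + zz α x w‖ := by
  have hn : ‖cexp (-((α * w.im : ℝ) : ℂ) * I)‖ = 1 := by
    rw [← ofReal_neg, Complex.norm_exp_ofReal_mul_I]
  have h2 : ‖1 + zz α x w‖ = ‖cexp (-((α * w.im : ℝ) : ℂ) * I) * (1 + zz α x w)‖ := by
    rw [norm_mul, hn, one_mul]
  have h3 : cexp (-((α * w.im : ℝ) : ℂ) * I) * (1 + zz α x w) =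
      cexp (((-(α * w.im) : ℝ) : ℂ) * I) + ((x⁻¹ * Real.exp (α * w.re) : ℝ) : ℂ) := by
    unfold zz
    rw [mul_add, mul_one, mul_left_comm, ← Complex.exp_add]
    push_cast
    congr 3
    linear_combination (-(α : ℂ)) * Complex.re_add_im w
  rw [h2, h3]
  refine le_trans ?_ (Complex.abs_im_le_norm _)
  rw [add_im, ofReal_im, add_zero, Complex.exp_ofReal_mul_I_im, Real.sin_neg, abs_neg]
  have hpos : 0 ≤ Real.pi * α := by have := Real.pi_pos; positivity
  rcases abs_eq Real.pi_pos.le |>.1 hw with h | h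
  · rw [h, mul_comm]; exact le_abs_self _
  · rw [h, mul_neg, Real.sin_neg, abs_neg, mul_comm]; exact le_abs_self _

lemma sin_pos' {α : ℝ} (h0 : 0 < α) (h1 : α < 1) : 0 < Real.sin (Real.pi * α) := by
  have := Real.pi_pos
  exact Real.sin_pos_of_pos_of_lt_pi (by positivity) (by nlinarith)

lemma exp_mul_pow (α x : ℝ) (l : ℕ) (w : ℂ) :
    cexp (cexp w) * zz α x w ^ l = (x : ℂ)⁻¹ ^ l * E (-(l : ℝ) * α) w := by
  unfold zz E
  rw [mul_pow, ← Complex.exp_nat_mul, mul_left_comm, ← Complex.exp_add]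
  push_cast
  ring_nf

lemma exp_mul_inv_pow {α x : ℝ} (k : ℕ) (w : ℂ) :
    cexp (cexp w) * (zz α x w)⁻¹ ^ k = (x : ℂ) ^ k * E ((k : ℝ) * α) w := by
  unfold zz E
  rw [mul_inv, inv_inv, ← Complex.exp_neg, mul_pow, ← Complex.exp_nat_mul, mul_left_comm,
    ← Complex.exp_add]
  push_cast
  ring_nf

lemma good_GG {α x : ℝ} (h0 : 0 < α) (h1 : α < 1) (hx : 0 < x) : Good (GG α x) := by
  have hs := sin_pos' h0 h1
  refine good_of_bound (-((1 : ℕ) : ℝ) * α) (M := x⁻¹ / Real.sin (Real.pi * α)) (fun w hw => ?_)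
    (fun w hw => ?_)
  · have hne := one_add_zz_ne h0 h1 hx hw
    unfold GG
    have hz : DifferentiableAt ℂ (zz α x) w := by unfold zz; fun_prop
    refine DifferentiableAt.mul (by fun_prop) (hz.div (hz.const_add 1) hne)
  · have h := exp_mul_pow α x 1 w
    rw [pow_one, pow_one] at h
    unfold GG
    rw [← mul_div_assoc, h, norm_div, norm_mul, norm_inv, Complex.norm_real,
      Real.norm_of_nonneg hx.le, div_mul_eq_mul_div]
    exact div_le_div_of_nonneg_left (by positivity) hs (sin_le_norm hw h0 h1)

lemma geom_small (z : ℂ) (hz : z ≠ 0) (hz1 : 1 + z ≠ 0) (N : ℕ) :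
    z / (1 + z) + ∑ k ∈ Finset.range N, -((-1) ^ k * z⁻¹ ^ k) =
      (-1) ^ N * z⁻¹ ^ N * (z / (1 + z)) := by
  induction N with
  | zero => simp
  | succ N ih =>
    rw [Finset.sum_range_succ, ← add_assoc, ih]
    have : z⁻¹ ^ N = z⁻¹ ^ (N + 1) * z := by
      rw [pow_succ]; field_simp
    rw [this]
    field_simp
    ring

lemma geom_large (z : ℂ) (hz1 : 1 + z ≠ 0) (N : ℕ) :
    z / (1 + z) + ∑ l ∈ Finset.Icc 1 N, -((-1) ^ (l - 1) * z ^ l) =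
      (-1) ^ N * z ^ (N + 1) / (1 + z) := by
  induction N with
  | zero => simp
  | succ N ih =>
    rw [Finset.sum_Icc_succ_top (by omega), ← add_assoc, ih]
    rw [Nat.add_sub_cancel]
    field_simp
    ring

lemma hasSum_of_eq {A : Type*} [AddCommMonoid A] [TopologicalSpace A] {f g : ℕ → A} {a : A}
    (h : HasSum f a) (hfg : ∀ k, g k = f k) : HasSum g a := by
  rwa [funext hfg]

lemma hasSum_GG {α x : ℝ} (h0 : 0 < α) (h1 : α < 1) (hx : 0 < x) :
    HasSum (fun k : ℕ => ((((-x) ^ k / Real.Gamma (k * α + 1) : ℝ)) : ℂ))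
      (J (GG α x) 0 / (2 * Real.pi * I)) := by
  have hpi : (2 * Real.pi * I : ℂ) ≠ 0 := by
    have : (Real.pi : ℂ) ≠ 0 := by exact_mod_cast Real.pi_ne_zero
    simp [this]
  set c : ℝ := Real.log (2 * x) / α with hc
  have hec : Real.exp (α * c) = 2 * x := by
    rw [hc, mul_div_cancel₀ _ h0.ne', Real.exp_log (by linarith)]
  have hz : ∀ w : ℂ, c ≤ w.re → ‖(zz α x w)⁻¹‖ ≤ 1 / 2 := by
    intro w hw
    rw [norm_inv, norm_zz hx]
    have : 2 * x ≤ Real.exp (α * w.re) := by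
      rw [← hec]; exact Real.exp_le_exp.2 (mul_le_mul_of_nonneg_left hw h0.le)
    rw [one_div]
    apply inv_anti₀ (by norm_num)
    rw [inv_mul_eq_div, le_div_iff₀ hx]
    exact this
  obtain ⟨K, hK0, hK⟩ := J_bound 0 c
  have hE0 : ∀ w, cexp (cexp w) = E 0 w := fun w => by simp [E]
  have hg := good_GG h0 h1 hx
  have hterm : ∀ k : ℕ, ‖((-x : ℝ) : ℂ) ^ k * J (E ((k : ℝ) * α)) c‖ ≤ (1 / 2) ^ k * K := by
    intro k
    rw [← J_const_mul]
    apply hK _ _ (by positivity)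
    intro w hw _ _
    have h := exp_mul_inv_pow (α := α) (x := x) k w
    rw [ofReal_neg, neg_pow, mul_assoc, ← h, hE0, norm_mul, norm_mul, norm_pow, norm_neg, norm_one,
      one_pow, one_mul, mul_comm, norm_pow]
    exact mul_le_mul_of_nonneg_right (pow_le_pow_left₀ (norm_nonneg _) (hz w hw) k) (norm_nonneg _)
  have hsumm : Summable (fun k : ℕ => ((-x : ℝ) : ℂ) ^ k * J (E ((k : ℝ) * α)) c) := by
    refine Summable.of_norm_bounded (g := fun k : ℕ => (1 / 2 : ℝ) ^ k * K) ?_ hterm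
    exact (summable_geometric_of_lt_one (by norm_num) (by norm_num)).mul_right K
  have hlim : Tendsto (fun N : ℕ => ∑ k ∈ Finset.range N,
      ((-x : ℝ) : ℂ) ^ k * J (E ((k : ℝ) * α)) c) atTop (𝓝 (J (GG α x) c)) := by
    rw [tendsto_iff_norm_sub_tendsto_zero]
    have hgeo : Tendsto (fun N : ℕ => ((1 / 2 : ℝ) ^ N * 2) * K) atTop (𝓝 0) := by
      have := (tendsto_pow_atTop_nhds_zero_of_lt_one (r := (1 / 2 : ℝ)) (by norm_num)
        (by norm_num)).mul_const 2 |>.mul_const K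
      simpa using this
    refine squeeze_zero (fun _ => norm_nonneg _) (fun N => ?_) hgeo
    have hJ : J (fun w => GG α x w + ∑ k ∈ Finset.range N,
        (-((-x : ℝ) : ℂ) ^ k) * E ((k : ℝ) * α) w) c =
        J (GG α x) c - ∑ k ∈ Finset.range N, ((-x : ℝ) : ℂ) ^ k * J (E ((k : ℝ) * α)) c := by
      rw [J_add hg (good_sum _ _ _ fun k => good_E _), J_sum _ _ _ fun k => good_E _]
      simp [Finset.sum_neg_distrib, sub_eq_add_neg]
    rw [norm_sub_rev, ← hJ]
    apply hK _ _ (by positivity)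
    intro w hw him _
    have hne := zz_ne (α := α) hx w
    have hne1 := one_add_zz_ne h0 h1 hx him
    have hgs := geom_small (zz α x w) hne hne1 N
    have heq : GG α x w + ∑ k ∈ Finset.range N, (-((-x : ℝ) : ℂ) ^ k) * E ((k : ℝ) * α) w =
        cexp (cexp w) * ((-1) ^ N * (zz α x w)⁻¹ ^ N * (zz α x w / (1 + zz α x w))) := by
      rw [← hgs, mul_add, Finset.mul_sum]
      unfold GG
      congr 1
      refine Finset.sum_congr rfl fun k _ => ?_
      have h := exp_mul_inv_pow (α := α) (x := x) k w
      rw [ofReal_neg, neg_pow (x : ℂ)]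
      linear_combination ((-1) ^ k) * h
    have hq : ‖zz α x w / (1 + zz α x w)‖ ≤ 2 := by
      have : zz α x w / (1 + zz α x w) = (1 + (zz α x w)⁻¹)⁻¹ := by
        have : 1 + (zz α x w)⁻¹ = (1 + zz α x w) / zz α x w := by field_simp; ring
        rw [this, inv_div]
      rw [this, norm_inv]
      have h3 : (1 / 2 : ℝ) ≤ ‖1 + (zz α x w)⁻¹‖ := by
        have := norm_sub_le_norm_add (1 : ℂ) (zz α x w)⁻¹
        rw [norm_one] at this
        linarith [hz w hw]
      calc _ ≤ (1 / 2 : ℝ)⁻¹ := inv_anti₀ (by norm_num) h3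
        _ = 2 := by norm_num
    rw [heq, hE0, norm_mul, norm_mul, norm_mul, norm_pow, norm_neg, norm_one, one_pow, one_mul,
      norm_pow, mul_comm]
    refine mul_le_mul_of_nonneg_right ?_ (norm_nonneg _)
    exact mul_le_mul (pow_le_pow_left₀ (norm_nonneg _) (hz w hw) N) hq (norm_nonneg _)
      (by positivity)
  have hS : HasSum (fun k : ℕ => ((-x : ℝ) : ℂ) ^ k * J (E ((k : ℝ) * α)) c) (J (GG α x) 0) := by
    rw [hsumm.hasSum_iff_tendsto_nat, J_indep hg 0 c]
    exact hlim
  refine hasSum_of_eq (hS.div_const (2 * Real.pi * I)) fun k => ?_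
  rw [J_E_val]
  push_cast
  field_simp

lemma ml_eq {α x : ℝ} (h0 : 0 < α) (h1 : α < 1) (hx : 0 < x) :
    Summable (fun k : ℕ => (-x) ^ k / Real.Gamma (k * α + 1)) ∧
    2 * Real.pi * I * ((∑' k : ℕ, (-x) ^ k / Real.Gamma (k * α + 1) : ℝ) : ℂ) = J (GG α x) 0 := by
  have hpi : (2 * Real.pi * I : ℂ) ≠ 0 := by
    have : (Real.pi : ℂ) ≠ 0 := by exact_mod_cast Real.pi_ne_zero
    simp [this]
  have h := hasSum_GG h0 h1 hx
  refine ⟨Complex.summable_ofReal.1 h.summable, ?_⟩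
  rw [Complex.ofReal_tsum, h.tsum_eq]
  field_simp

lemma ml_asymp {α : ℝ} (h0 : 0 < α) (h1 : α < 1) (N : ℕ) : ∃ C : ℝ, ∀ x : ℝ, 2 ≤ x →
    |(∑' k : ℕ, (-x) ^ k / Real.Gamma (k * α + 1)) -
      ∑ l ∈ Finset.Icc 1 N, (-1) ^ (l - 1) * x⁻¹ ^ l / Real.Gamma (-(l : ℝ) * α + 1)| ≤
      C * x⁻¹ ^ (N + 1) := by
  have hpi : (2 * Real.pi * I : ℂ) ≠ 0 := by
    have : (Real.pi : ℂ) ≠ 0 := by exact_mod_cast Real.pi_ne_zero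
    simp [this]
  have hs := sin_pos' h0 h1
  obtain ⟨K, hK0, hK⟩ := J_bound (-((N + 1 : ℕ) : ℝ) * α) 0
  set D : ℝ := max 2 (Real.sin (Real.pi * α))⁻¹ with hD
  have hD0 : 0 < D := lt_of_lt_of_le two_pos (le_max_left _ _)
  refine ⟨D * K / (2 * Real.pi), fun x hx2 => ?_⟩
  have hx : 0 < x := by linarith
  have hg := good_GG h0 h1 hx
  have hJ : J (fun w => GG α x w + ∑ l ∈ Finset.Icc 1 N,
        (-((-1) ^ (l - 1) * (x : ℂ)⁻¹ ^ l)) * E (-(l : ℝ) * α) w) 0 =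
        2 * Real.pi * I * (((∑' k : ℕ, (-x) ^ k / Real.Gamma (k * α + 1)) -
      ∑ l ∈ Finset.Icc 1 N, (-1) ^ (l - 1) * x⁻¹ ^ l / Real.Gamma (-(l : ℝ) * α + 1) : ℝ) : ℂ) := by
    rw [J_add hg (good_sum _ _ _ fun k => good_E _), J_sum _ _ _ fun k => good_E _, ofReal_sub,
      mul_sub, (ml_eq h0 h1 hx).2, sub_eq_add_neg]
    congr 1
    rw [ofReal_sum, Finset.mul_sum, ← Finset.sum_neg_distrib]
    refine Finset.sum_congr rfl fun l _ => ?_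
    rw [J_E_val]
    push_cast
    ring
  have hb := hK (fun w => GG α x w + ∑ l ∈ Finset.Icc 1 N,
        (-((-1) ^ (l - 1) * (x : ℂ)⁻¹ ^ l)) * E (-(l : ℝ) * α) w) (x⁻¹ ^ (N + 1) * D)
        (by positivity) (by
    intro w _ him hw
    have hne1 := one_add_zz_ne h0 h1 hx him
    have hgl := geom_large (zz α x w) hne1 N
    have heq : GG α x w + ∑ l ∈ Finset.Icc 1 N,
        (-((-1) ^ (l - 1) * (x : ℂ)⁻¹ ^ l)) * E (-(l : ℝ) * α) w =
        (-1) ^ N * (cexp (cexp w) * zz α x w ^ (N + 1)) / (1 + zz α x w) := by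
      have : (-1) ^ N * (cexp (cexp w) * zz α x w ^ (N + 1)) / (1 + zz α x w) =
        cexp (cexp w) * ((-1) ^ N * zz α x w ^ (N + 1) / (1 + zz α x w)) := by ring
      rw [this, ← hgl, mul_add, Finset.mul_sum]
      unfold GG
      congr 1
      refine Finset.sum_congr rfl fun l _ => ?_
      have h := exp_mul_pow α x l w
      linear_combination ((-1) ^ (l - 1)) * h
    have hlow : ‖1 + zz α x w‖⁻¹ ≤ D := by
      rcases hw with hw | hw
      · refine le_trans ?_ (le_max_left _ _)
        have h3 : (1 / 2 : ℝ) ≤ ‖1 + zz α x w‖ := by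
          have := norm_sub_le_norm_add (1 : ℂ) (zz α x w)
          rw [norm_one, norm_zz hx, hw, mul_zero, Real.exp_zero, mul_one] at this
          have : x⁻¹ ≤ 2⁻¹ := inv_anti₀ two_pos hx2
          linarith
        calc _ ≤ (1 / 2 : ℝ)⁻¹ := inv_anti₀ (by norm_num) h3
          _ = 2 := by norm_num
      · exact le_trans (inv_anti₀ hs (sin_le_norm hw h0 h1)) (le_max_right _ _)
    rw [heq, exp_mul_pow, norm_div, norm_mul, norm_mul, norm_pow, norm_pow, norm_neg, norm_one,
      one_pow, one_mul, norm_inv, Complex.norm_real, Real.norm_of_nonneg hx.le, div_eq_mul_inv,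
      mul_right_comm]
    refine mul_le_mul_of_nonneg_right ?_ (norm_nonneg _)
    exact mul_le_mul_of_nonneg_left hlow (by positivity))
  rw [hJ, norm_mul, Complex.norm_real, Real.norm_eq_abs] at hb
  have h2pi : ‖(2 * Real.pi * I : ℂ)‖ = 2 * Real.pi := by
    simp [abs_of_pos Real.pi_pos]
  rw [h2pi] at hb
  have hp : 0 < 2 * Real.pi := by have := Real.pi_pos; positivity
  rw [div_mul_eq_mul_div, le_div_iff₀ hp]
  linarith

/-- Pointwise facts, for all `0 < α ≤ 1`. -/
lemma ml_all {α : ℝ} (h0 : 0 < α) (h1 : α ≤ 1) (N : ℕ) :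
    (∀ x : ℝ, 0 < x → Summable (fun k : ℕ => (-x) ^ k / Real.Gamma (k * α + 1))) ∧
    ∃ C X : ℝ, ∀ x : ℝ, X ≤ x →
    |(∑' k : ℕ, (-x) ^ k / Real.Gamma (k * α + 1)) -
      ∑ l ∈ Finset.Icc 1 N, (-1) ^ (l - 1) * x⁻¹ ^ l / Real.Gamma (-(l : ℝ) * α + 1)| ≤
      C * x⁻¹ ^ (N + 1) := by
  rcases lt_or_eq_of_le h1 with h | h
  · refine ⟨fun x hx => (ml_eq h0 h hx).1, ?_⟩
    obtain ⟨C, hC⟩ := ml_asymp h0 h N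
    exact ⟨C, 2, hC⟩
  · subst h
    have hs : ∀ x : ℝ, HasSum (fun k : ℕ => (-x) ^ k / Real.Gamma (k * 1 + 1)) (Real.exp (-x)) := by
      intro x
      have := NormedSpace.expSeries_div_hasSum_exp (𝔸 := ℝ) (-x)
      rw [← Real.exp_eq_exp_ℝ] at this
      refine hasSum_of_eq this fun k => ?_
      rw [mul_one, Real.Gamma_nat_eq_factorial]
    refine ⟨fun x _ => (hs x).summable, (N + 1).factorial, 1, fun x hx => ?_⟩
    have hx0 : 0 < x := by linarith
    rw [(hs x).tsum_eq]
    have hz : ∑ l ∈ Finset.Icc 1 N, (-1 : ℝ) ^ (l - 1) * x⁻¹ ^ l / Real.Gamma (-(l : ℝ) * 1 + 1)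
        = 0 := by
      refine Finset.sum_eq_zero fun l hl => ?_
      have hl1 : 1 ≤ l := (Finset.mem_Icc.1 hl).1
      have : -(l : ℝ) * 1 + 1 = -((l - 1 : ℕ) : ℝ) := by
        push_cast [Nat.cast_sub hl1]; ring
      rw [this, Real.Gamma_neg_nat_eq_zero, div_zero]
    rw [hz, sub_zero, abs_of_pos (Real.exp_pos _), Real.exp_neg, inv_pow, ← div_eq_mul_inv,
      inv_eq_one_div, div_le_div_iff₀ (Real.exp_pos _) (by positivity), one_mul]
    have := Real.pow_div_factorial_le_exp x hx0.le (N + 1)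
    rw [div_le_iff₀ (by positivity)] at this
    linarith

end GST

/-- The Mittag-Leffler function `E_α(x) = Σ_{k≥0} x^k / Γ(kα+1)` (real argument). -/
noncomputable def mittagLeffler (a x : ℝ) : ℝ :=
  ∑' k : ℕ, x ^ k / Real.Gamma (k * a + 1)

/-- Asymptotic expansion of the Lévy tail of a geometric `α`-stable subordinator:
`∫_x^∞ α E_α(-t^α)/t dt = Σ_{ℓ=1}^{n+1} (-1)^{ℓ-1} x^{-ℓα}/(ℓ Γ(-ℓα+1)) + O(x^{-(n+2)α})`
as `x → +∞`. -/
theorem geometric_stable_tail_asymptotic (α : ℝ) (hα0 : 0 < α) (hα1 : α ≤ 1) (n : ℕ) :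
    (fun x : ℝ =>
        (∫ t in Set.Ioi x, α * mittagLeffler α (-(t ^ α)) / t) -
          ∑ l ∈ Finset.Icc 1 (n + 1),
            (-1 : ℝ) ^ (l - 1) * x ^ (-(l : ℝ) * α) /
              (l * Real.Gamma (-(l : ℝ) * α + 1)))
      =O[atTop] (fun x : ℝ => x ^ (-((n : ℝ) + 2) * α)) := by
  obtain ⟨hsum, C, X, hC⟩ := GST.ml_all hα0 hα1 (n + 1)
  refine IsBigO.of_bound (C / (n + 2)) ?_
  have hXt := (tendsto_rpow_atTop hα0).eventually_ge_atTop X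
  obtain ⟨T, hT⟩ := eventually_atTop.1 hXt
  filter_upwards [eventually_ge_atTop T, eventually_gt_atTop 0] with x hxT hx0
  have hpow : ∀ t : ℝ, 0 < t → ∀ l : ℕ, (t ^ α)⁻¹ ^ l = t ^ (-(l : ℝ) * α) := by
    intro t ht l
    rw [inv_pow, ← Real.rpow_natCast, ← Real.rpow_mul ht.le, ← Real.rpow_neg ht.le]
    ring_nf
  have hdivt : ∀ t : ℝ, 0 < t → ∀ s : ℝ, t ^ s / t = t ^ (s - 1) := by
    intro t ht s
    rw [Real.rpow_sub_one ht.ne']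
  -- integrals of powers
  have hint : ∀ s : ℝ, 0 < s → IntegrableOn (fun t : ℝ => t ^ (-s - 1)) (Set.Ioi x) := fun s hs =>
    integrableOn_Ioi_rpow_of_lt (by linarith) hx0
  have hval : ∀ s : ℝ, 0 < s → ∫ t in Set.Ioi x, t ^ (-s - 1) = x ^ (-s) / s := fun s hs => by
    rw [integral_Ioi_rpow_of_lt (by linarith) hx0, sub_add_cancel, neg_div_neg_eq]
  set a : ℕ → ℝ := fun l => α * (-1) ^ (l - 1) / Real.Gamma (-(l : ℝ) * α + 1) with ha
  set S : ℝ → ℝ := fun t => ∑ l ∈ Finset.Icc 1 (n + 1), a l * t ^ (-(l * α) - 1) with hS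
  have hlpos : ∀ l ∈ Finset.Icc 1 (n + 1), 0 < (l : ℝ) * α := by
    intro l hl
    have : 0 < l := (Finset.mem_Icc.1 hl).1
    positivity
  have hSint : IntegrableOn S (Set.Ioi x) := by
    refine integrable_finsetSum _ fun l hl => ?_
    exact (hint _ (hlpos l hl)).const_mul (a l)
  have hSval : ∫ t in Set.Ioi x, S t = ∑ l ∈ Finset.Icc 1 (n + 1),
            (-1 : ℝ) ^ (l - 1) * x ^ (-(l : ℝ) * α) /
              (l * Real.Gamma (-(l : ℝ) * α + 1)) := by
    rw [integral_finsetSum _ fun l hl => (hint _ (hlpos l hl)).const_mul (a l)]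
    refine Finset.sum_congr rfl fun l hl => ?_
    have hl' := hlpos l hl
    have hl0 : (l : ℝ) ≠ 0 := by rintro h; simp [h] at hl'
    rw [integral_const_mul, hval _ hl', ha]
    simp only [neg_mul]
    rw [div_mul_div_comm, mul_assoc α, show Real.Gamma (-(l * α) + 1) * (l * α) =
      α * (l * Real.Gamma (-(l * α) + 1)) by ring, mul_div_mul_left _ _ hα0.ne']
  set f : ℝ → ℝ := fun t => α * mittagLeffler α (-(t ^ α)) / t with hf
  have hfm : AEStronglyMeasurable f (volume.restrict (Set.Ioi x)) := by
    refine aestronglyMeasurable_of_tendsto_ae (u := atTop) (f := fun (N : ℕ) (t : ℝ) =>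
      α * (∑ k ∈ Finset.range N, (-(t ^ α)) ^ k / Real.Gamma (k * α + 1)) / t) ?_ ?_
    · intro N
      apply Measurable.aestronglyMeasurable
      fun_prop
    · refine (ae_restrict_iff' measurableSet_Ioi).2 (Eventually.of_forall fun t ht => ?_)
      have ht0 : 0 < t := hx0.trans ht
      exact (((hsum _ (Real.rpow_pos_of_pos ht0 α)).hasSum.tendsto_sum_nat).const_mul α).div_const t
  have hbd : ∀ t ∈ Set.Ioi x, ‖f t - S t‖ ≤ α * C * t ^ (-((n + 2) * α) - 1) := by
    intro t ht
    have ht0 : 0 < t := hx0.trans ht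
    have h := hC (t ^ α) (hT t (hxT.trans (le_of_lt ht)))
    have h1 : f t - S t = α / t * ((∑' k : ℕ, (-(t ^ α)) ^ k / Real.Gamma (k * α + 1)) -
      ∑ l ∈ Finset.Icc 1 (n + 1), (-1) ^ (l - 1) * (t ^ α)⁻¹ ^ l /
        Real.Gamma (-(l : ℝ) * α + 1)) := by
      rw [hf, hS, mul_sub, Finset.mul_sum]
      simp only [mittagLeffler]
      congr 1
      · ring
      · refine Finset.sum_congr rfl fun l _ => ?_
        rw [hpow t ht0, ← hdivt t ht0, ha]
        simp only [neg_mul]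
        ring
    rw [h1, norm_mul, Real.norm_eq_abs, Real.norm_eq_abs, abs_of_pos (by positivity)]
    refine (mul_le_mul_of_nonneg_left h (by positivity)).trans (le_of_eq ?_)
    rw [hpow t ht0, ← hdivt t ht0]
    push_cast
    ring_nf
  have hn2 : 0 < ((n : ℝ) + 2) * α := by positivity
  have hbint := (hint _ hn2).const_mul (α * C)
  have hae : ∀ᵐ t ∂(volume.restrict (Set.Ioi x)),
      ‖f t - S t‖ ≤ α * C * t ^ (-((n + 2) * α) - 1) :=
    (ae_restrict_iff' measurableSet_Ioi).2 (Eventually.of_forall hbd)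
  have hRint : IntegrableOn (fun t => f t - S t) (Set.Ioi x) :=
    Integrable.mono' hbint (hfm.sub hSint.aestronglyMeasurable) hae
  have hfint : IntegrableOn f (Set.Ioi x) := by
    refine (hRint.add hSint).congr (Eventually.of_forall fun t => ?_)
    simp
  rw [← hSval, ← integral_sub hfint hSint]
  refine (norm_integral_le_of_norm_le hbint hae).trans (le_of_eq ?_)
  rw [integral_const_mul, hval _ hn2, Real.norm_of_nonneg (Real.rpow_nonneg hx0.le _), neg_mul]
  field_simp
end
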